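/- arXiv:2602.16067 — 2 statements merged into one kernel-verified Lean document; each statement's English description precedes it below -/
import Mathlib

section
/- Let D = Σ_j D_{L_j} be an arbitrary total dissipator on M_2(ℂ). Then the following are equivalent: (i) D is Hamiltonian-independently contractive; (ii) the constant Lindbladian L = D (with zero Hamiltonian) is exponentially contractive; (iii) the set {L_j, L_j† : j} generates the full complex matrix algebra M_2(ℂ) (the smallest subset containing it and closed under addition, complex scalar multiplication and matrix multiplication is M_2(ℂ)); (iv) at least one jump operator L_j is a non-normal matrix (L_j L_j† ≠ L_j† L_j), or at least two jump operators L_j, L_k do not commute. -/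
open scoped ComplexOrder Kronecker
open Matrix

namespace Paper

variable {n : Type*} [Fintype n] [DecidableEq n]

/-- Trace norm: sum of singular values. -/
noncomputable def traceNorm (A : Matrix n n ℂ) : ℝ :=
  ∑ i, Real.sqrt ((Matrix.posSemidef_conjTranspose_mul_self A).isHermitian.eigenvalues i)

/-- The dissipator associated with a single jump operator. -/
noncomputable def dissipator (L x : Matrix n n ℂ) : Matrix n n ℂ :=
  L * x * Lᴴ - ((1 : ℂ)/2) • (Lᴴ * L * x + x * (Lᴴ * L))

/-- Total dissipator of a family of jump operators. -/
noncomputable def totalDissipator {m : ℕ} (L : Fin m → Matrix n n ℂ) (x : Matrix n n ℂ) :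
    Matrix n n ℂ :=
  ∑ j, dissipator (L j) x

/-- The Hamiltonian commutator term `-i[H, x]`. -/
noncomputable def hamTerm (H x : Matrix n n ℂ) : Matrix n n ℂ :=
  (-Complex.I) • (H * x - x * H)

/-- A solution of the master equation `ρ' = L_t(ρ)` starting at time `s`
(differentiable entrywise). -/
def IsSolution (Lt : ℝ → Matrix n n ℂ → Matrix n n ℂ) (s : ℝ) (ρ : ℝ → Matrix n n ℂ) : Prop :=
  ∀ t, s ≤ t → ∀ i j, HasDerivAt (fun u => ρ u i j) ((Lt t (ρ t)) i j) t

/-- Density matrix: Hermitian, positive semidefinite, trace one. -/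
def IsDensity (ρ : Matrix n n ℂ) : Prop := ρ.PosSemidef ∧ ρ.trace = 1

/-- Exponential contractivity with constants `K, γ` of a time-dependent Lindbladian. -/
def ExpContractiveWith (Lt : ℝ → Matrix n n ℂ → Matrix n n ℂ) (K γ : ℝ) : Prop :=
  ∀ s t : ℝ, 0 ≤ s → s ≤ t → ∀ ρ σ : ℝ → Matrix n n ℂ,
    IsSolution Lt s ρ → IsSolution Lt s σ → IsDensity (ρ s) → IsDensity (σ s) →
    traceNorm (ρ t - σ t) ≤ K * Real.exp (-γ * (t - s)) * traceNorm (ρ s - σ s)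

/-- Exponential contractivity of a time-dependent Lindbladian. -/
def ExpContractive (Lt : ℝ → Matrix n n ℂ → Matrix n n ℂ) : Prop :=
  ∃ K γ : ℝ, 0 < K ∧ 0 < γ ∧ ExpContractiveWith Lt K γ

/-- Time-dependent Hamiltonian: Hermitian values and continuous entries. -/
def IsHamiltonianFamily (H : ℝ → Matrix n n ℂ) : Prop :=
  (∀ t, (H t).IsHermitian) ∧ ∀ i j, Continuous fun t => H t i j

/-- Driven Lindbladian `x ↦ -i[H(t), x] + D(x)`. -/
noncomputable def driven {m : ℕ} (H : ℝ → Matrix n n ℂ) (L : Fin m → Matrix n n ℂ)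
    (t : ℝ) (x : Matrix n n ℂ) : Matrix n n ℂ :=
  hamTerm (H t) x + totalDissipator L x

/-- Hamiltonian-independent contractivity of a dissipator. -/
def HamIndepContractive {m : ℕ} (L : Fin m → Matrix n n ℂ) : Prop :=
  ∀ H : ℝ → Matrix n n ℂ, IsHamiltonianFamily H → ExpContractive (driven H L)

/-- The operator norm (largest singular value). -/
noncomputable def opNorm (A : Matrix n n ℂ) : ℝ :=
  ‖LinearMap.toContinuousLinearMap (Matrix.toEuclideanLin A)‖

end Paper

namespace Paper


abbrev M2 := Matrix (Fin 2) (Fin 2) ℂ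

/-- squared Frobenius norm -/
noncomputable def fro (A : M2) : ℝ := ∑ i, ∑ j, Complex.normSq (A i j)

/-- real Frobenius inner product -/
noncomputable def ip (A B : M2) : ℝ := ∑ i, ∑ j, ((A i j).re * (B i j).re + (A i j).im * (B i j).im)

/-- hermitian and antihermitian parts (up to scaling) -/
noncomputable def hp (b : Bool) (A : M2) : M2 :=
  if b then A + Aᴴ else Complex.I • (A - Aᴴ)

lemma hp_herm (b : Bool) (A : M2) : (hp b A)ᴴ = hp b A := by
  cases b
  · simp only [hp, Bool.false_eq_true, if_false]
    ext i j
    simp [Matrix.conjTranspose_apply]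
    ring
  · simp [hp, add_comm]

lemma hp_rec (A : M2) : A = (1/2 : ℂ) • hp true A - (Complex.I/2) • hp false A := by
  ext i j
  simp [hp]
  linear_combination (1/2) * (A i j - (starRingEnd ℂ) (A j i)) * Complex.I_mul_I

lemma hp_rec' (A : M2) : Aᴴ = (1/2 : ℂ) • hp true A + (Complex.I/2) • hp false A := by
  ext i j
  simp [hp]
  linear_combination -(1/2) * (A i j - (starRingEnd ℂ) (A j i)) * Complex.I_mul_I

lemma ip_dissipator (L x : M2) (hx : x 1 1 = - x 0 0) :
    ip x (dissipator L x) = -(1/8) * (fro (x * hp true L - hp true L * x)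
      + fro (x * hp false L - hp false L * x)) := by
  simp [ip, fro, dissipator, hp, Matrix.mul_apply, Fin.sum_univ_two, Complex.normSq_apply, hx]
  ring

lemma ip_ham (H x : M2) (hH : Hᴴ = H) : ip x (hamTerm H x) = 0 := by
  have h00 := congrFun (congrFun hH 0) 0
  have h01 := congrFun (congrFun hH 0) 1
  have h11 := congrFun (congrFun hH 1) 1
  simp only [Matrix.conjTranspose_apply, Complex.ext_iff, Complex.star_def, Complex.conj_re,
    Complex.conj_im] at h00 h01 h11
  have a : (H 0 0).im = 0 := by linarith [h00.2]
  have b : (H 1 1).im = 0 := by linarith [h11.2]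
  have c : (H 0 1).re = (H 1 0).re := by linarith [h01.1]
  have d : (H 0 1).im = -(H 1 0).im := by linarith [h01.2]
  simp [ip, hamTerm, Matrix.mul_apply, Fin.sum_univ_two, a, b, c, d]
  ring

lemma real_gap (p1 p2 p3 u1 u2 u3 w1 w2 w3 : ℝ) :
    ((u2*w3-u3*w2)^2+(u3*w1-u1*w3)^2+(u1*w2-u2*w1)^2) * (p1^2+p2^2+p3^2) ≤
    2 * (u1^2+u2^2+u3^2+w1^2+w2^2+w3^2) *
     (((p2*u3-p3*u2)^2+(p3*u1-p1*u3)^2+(p1*u2-p2*u1)^2)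
     + ((p2*w3-p3*w2)^2+(p3*w1-p1*w3)^2+(p1*w2-p2*w1)^2)) := by
  -- U = p × u, V = p × w; Lagrange
  have key : ∀ U1 U2 U3 V1 V2 V3 : ℝ, 
      ((U2*w3-U3*w2) + (u2*V3-u3*V2))^2 + ((U3*w1-U1*w3) + (u3*V1-u1*V3))^2
      + ((U1*w2-U2*w1) + (u1*V2-u2*V1))^2 + (U1*w1+U2*w2+U3*w3)^2
      ≤ 2 * (u1^2+u2^2+u3^2+w1^2+w2^2+w3^2) * ((U1^2+U2^2+U3^2)+(V1^2+V2^2+V3^2)) := by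
    intro U1 U2 U3 V1 V2 V3
    have e1 : ∀ a b : ℝ, (a+b)^2 ≤ 2*a^2+2*b^2 := fun a b => by nlinarith [sq_nonneg (a-b)]
    have h1 := e1 (U2*w3-U3*w2) (u2*V3-u3*V2)
    have h2 := e1 (U3*w1-U1*w3) (u3*V1-u1*V3)
    have h3 := e1 (U1*w2-U2*w1) (u1*V2-u2*V1)
    have i1 : (U2*w3-U3*w2)^2+(U3*w1-U1*w3)^2+(U1*w2-U2*w1)^2+(U1*w1+U2*w2+U3*w3)^2
      = (U1^2+U2^2+U3^2)*(w1^2+w2^2+w3^2) := by ring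
    have i2 : (u2*V3-u3*V2)^2+(u3*V1-u1*V3)^2+(u1*V2-u2*V1)^2+(u1*V1+u2*V2+u3*V3)^2
      = (u1^2+u2^2+u3^2)*(V1^2+V2^2+V3^2) := by ring
    have q1 := sq_nonneg (U1*w1+U2*w2+U3*w3)
    have q2 := sq_nonneg (u1*V1+u2*V2+u3*V3)
    have q3 : 0 ≤ (u1^2+u2^2+u3^2)*(U1^2+U2^2+U3^2) := by positivity
    have q4 : 0 ≤ (w1^2+w2^2+w3^2)*(V1^2+V2^2+V3^2) := by positivity
    linarith
  refine le_trans (le_of_eq ?_) (key (p2*u3-p3*u2) (p3*u1-p1*u3) (p1*u2-p2*u1)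
    (p2*w3-p3*w2) (p3*w1-p1*w3) (p1*w2-p2*w1))
  ring

lemma fro_nonneg (A : M2) : 0 ≤ fro A :=
  Finset.sum_nonneg fun _ _ => Finset.sum_nonneg fun _ _ => Complex.normSq_nonneg _

lemma fro_eq_zero {A : M2} (h : fro A = 0) : A = 0 := by
  simp only [fro, Fin.sum_univ_two] at h
  have a := Complex.normSq_nonneg (A 0 0)
  have b := Complex.normSq_nonneg (A 0 1)
  have c := Complex.normSq_nonneg (A 1 0)
  have d := Complex.normSq_nonneg (A 1 1)
  ext i j
  apply Complex.normSq_eq_zero.1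
  fin_cases i <;> fin_cases j <;> simp <;> first | (apply Complex.normSq_eq_zero.1; linarith)

lemma herm_coords {A : M2} (hA : Aᴴ = A) : (A 0 0).im = 0 ∧ (A 1 1).im = 0 ∧
    (A 1 0).re = (A 0 1).re ∧ (A 1 0).im = -(A 0 1).im := by
  have h00 := congrFun (congrFun hA 0) 0
  have h01 := congrFun (congrFun hA 0) 1
  have h11 := congrFun (congrFun hA 1) 1
  simp only [Matrix.conjTranspose_apply, Complex.ext_iff, Complex.star_def, Complex.conj_re,
    Complex.conj_im] at h00 h01 h11
  exact ⟨by linarith [h00.2], by linarith [h11.2], by linarith [h01.1], by linarith [h01.2]⟩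

/-- traceless part, squared norm (up to scaling) of a Hermitian matrix -/
noncomputable def tq (A : M2) : ℝ :=
  (A 0 1).re^2 + (A 0 1).im^2 + (((A 0 0).re - (A 1 1).re)/2)^2

lemma gap_pair (A B x : M2) (hA : Aᴴ = A) (hB : Bᴴ = B) (hx : x 1 1 = - x 0 0) :
    fro (A * B - B * A) * fro x ≤
      4 * (tq A + tq B) * (fro (x * A - A * x) + fro (x * B - B * x)) := by
  obtain ⟨a1, a2, a3, a4⟩ := herm_coords hA
  obtain ⟨b1, b2, b3, b4⟩ := herm_coords hB
  have g1 := real_gap (((x 0 1).re + (x 1 0).re)/2) (((x 1 0).im - (x 0 1).im)/2) ((x 0 0).re)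
    (A 0 1).re (-(A 0 1).im) (((A 0 0).re - (A 1 1).re)/2)
    (B 0 1).re (-(B 0 1).im) (((B 0 0).re - (B 1 1).re)/2)
  have g2 := real_gap (((x 0 1).im + (x 1 0).im)/2) (((x 0 1).re - (x 1 0).re)/2) ((x 0 0).im)
    (A 0 1).re (-(A 0 1).im) (((A 0 0).re - (A 1 1).re)/2)
    (B 0 1).re (-(B 0 1).im) (((B 0 0).re - (B 1 1).re)/2)
  simp [tq, fro, Matrix.mul_apply, Fin.sum_univ_two, Complex.normSq_apply, hx, a1, a2, a3, a4,
    b1, b2, b3, b4]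
  linarith

lemma fro_deriv (δ δ' : ℝ → M2) (t : ℝ) (h : ∀ i j, HasDerivAt (fun u => δ u i j) (δ' t i j) t) :
    HasDerivAt (fun u => fro (δ u)) (2 * ip (δ t) (δ' t)) t := by
  have key : ∀ i j, HasDerivAt (fun u => Complex.normSq (δ u i j))
      (2 * ((δ t i j).re * (δ' t i j).re + (δ t i j).im * (δ' t i j).im)) t := by
    intro i j
    have hr : HasDerivAt (fun u => (δ u i j).re) (δ' t i j).re t :=
      Complex.reCLM.hasFDerivAt.comp_hasDerivAt t (h i j)
    have hi : HasDerivAt (fun u => (δ u i j).im) (δ' t i j).im t :=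
      Complex.imCLM.hasFDerivAt.comp_hasDerivAt t (h i j)
    have := (hr.mul hr).add (hi.mul hi)
    simp only [Complex.normSq_apply]
    refine this.congr_deriv ?_
    ring
  simp only [fro, ip, Fin.sum_univ_two]
  have := ((key 0 0).add (key 0 1)).add ((key 1 0).add (key 1 1))
  refine this.congr_deriv ?_
  ring

lemma sum_sv (A : M2) : ∑ i, (Matrix.posSemidef_conjTranspose_mul_self A).isHermitian.eigenvalues i
    = fro A := by
  have h := (Matrix.posSemidef_conjTranspose_mul_self A).isHermitian.trace_eq_sum_eigenvalues
  have h2 : (Aᴴ * A).trace = (fro A : ℂ) := by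
    apply Complex.ext
    · simp [Matrix.trace, Matrix.mul_apply, Fin.sum_univ_two, fro, Complex.normSq_apply]
      ring
    · simp [Matrix.trace, Matrix.mul_apply, Fin.sum_univ_two, fro, Complex.normSq_apply]
      ring
  rw [h2] at h
  have := congrArg Complex.re h
  simpa using this.symm

lemma traceNorm_nonneg (A : M2) : 0 ≤ traceNorm A :=
  Finset.sum_nonneg fun _ _ => Real.sqrt_nonneg _

lemma traceNorm_bounds (A : M2) : fro A ≤ traceNorm A ^ 2 ∧ traceNorm A ^ 2 ≤ 2 * fro A := by
  have h := sum_sv A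
  have hn := (Matrix.posSemidef_conjTranspose_mul_self A).eigenvalues_nonneg
  rw [← h]
  simp only [traceNorm, Fin.sum_univ_two]
  set e0 := (Matrix.posSemidef_conjTranspose_mul_self A).isHermitian.eigenvalues 0
  set e1 := (Matrix.posSemidef_conjTranspose_mul_self A).isHermitian.eigenvalues 1
  have h0 := Real.sq_sqrt (hn 0)
  have h1 := Real.sq_sqrt (hn 1)
  have p0 := Real.sqrt_nonneg e0
  have p1 := Real.sqrt_nonneg e1
  change √e0 ^ 2 = e0 at h0
  change √e1 ^ 2 = e1 at h1
  constructor
  · nlinarith [mul_nonneg p0 p1]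
  · nlinarith [sq_nonneg (√e0 - √e1)]

lemma ip_add (x a b : M2) : ip x (a + b) = ip x a + ip x b := by
  simp [ip, Fin.sum_univ_two]; ring

lemma ip_sum {m : ℕ} (x : M2) (a : Fin m → M2) : ip x (∑ j, a j) = ∑ j, ip x (a j) := by
  have h0 : ip x 0 = 0 := by simp [ip]
  exact map_sum (AddMonoidHom.mk' (ip x) (ip_add x)) a Finset.univ

lemma dissipator_sub (L x y : M2) : dissipator L (x - y) = dissipator L x - dissipator L y := by
  simp only [dissipator, Matrix.mul_sub, Matrix.sub_mul, smul_add, smul_sub]; abel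

lemma hamTerm_sub (H x y : M2) : hamTerm H (x - y) = hamTerm H x - hamTerm H y := by
  simp only [hamTerm, Matrix.mul_sub, Matrix.sub_mul, smul_sub]; abel

lemma driven_sub {m : ℕ} (H : ℝ → M2) (L : Fin m → M2) (t : ℝ) (x y : M2) :
    driven H L t (x - y) = driven H L t x - driven H L t y := by
  simp only [driven, totalDissipator, dissipator_sub, hamTerm_sub, Finset.sum_sub_distrib]; abel

lemma driven_trace {m : ℕ} (H : ℝ → M2) (L : Fin m → M2) (t : ℝ) (x : M2) :
    (driven H L t x).trace = 0 := by
  have h1 : ∀ L : M2, (dissipator L x).trace = 0 := by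
    intro L
    simp [dissipator, Matrix.trace, Matrix.mul_apply, Fin.sum_univ_two]
    ring
  simp only [driven, totalDissipator, Matrix.trace_add, Matrix.trace_sum, h1]
  simp [hamTerm, Matrix.trace, Matrix.mul_apply, Fin.sum_univ_two]
  ring

/-- pairs of non-commuting Hermitian parts -/
def NC {m : ℕ} (L : Fin m → M2) : Prop :=
  ∃ j b k c, hp b (L j) * hp c (L k) ≠ hp c (L k) * hp b (L j)

lemma gap {m : ℕ} (L : Fin m → M2) (h : NC L) : ∃ c : ℝ, 0 < c ∧
    ∀ (H x : M2), Hᴴ = H → x 1 1 = - x 0 0 →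
      ip x (hamTerm H x + totalDissipator L x) ≤ - c * fro x := by
  obtain ⟨j, b, k, c, hne⟩ := h
  set A := hp b (L j) with hAd
  set B := hp c (L k) with hBd
  have hC : 0 < fro (A * B - B * A) := by
    rcases (fro_nonneg (A * B - B * A)).lt_or_eq with h | h
    · exact h
    · exact absurd (sub_eq_zero.1 (fro_eq_zero h.symm)) hne
  have hT : 0 < tq A + tq B + 1 := by unfold tq; positivity
  refine ⟨fro (A * B - B * A) / (64 * (tq A + tq B + 1)), by positivity, ?_⟩
  intro H x hH hx
  rw [ip_add, ip_ham H x hH, totalDissipator, ip_sum]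
  have hd : ∀ l : Fin m, ip x (dissipator (L l) x) ≤ 0 := by
    intro l
    rw [ip_dissipator _ _ hx]
    nlinarith [fro_nonneg (x * hp true (L l) - hp true (L l) * x),
      fro_nonneg (x * hp false (L l) - hp false (L l) * x)]
  have hone : ∀ (l : Fin m) (b : Bool), ip x (dissipator (L l) x) ≤
      -(1/8) * fro (x * hp b (L l) - hp b (L l) * x) := by
    intro l b
    rw [ip_dissipator _ _ hx]
    cases b
    · linarith [fro_nonneg (x * hp true (L l) - hp true (L l) * x)]
    · linarith [fro_nonneg (x * hp false (L l) - hp false (L l) * x)]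
  have hs : ∀ l : Fin m, ∑ i, ip x (dissipator (L i) x) ≤ ip x (dissipator (L l) x) := by
    intro l
    rw [← Finset.add_sum_erase _ _ (Finset.mem_univ l)]
    linarith [Finset.sum_nonpos fun i (_ : i ∈ Finset.univ.erase l) => hd i]
  have s1 := (hs j).trans (hone j b)
  have s2 := (hs k).trans (hone k c)
  rw [← hAd] at s1
  rw [← hBd] at s2
  have g := gap_pair A B x (hp_herm _ _) (hp_herm _ _) hx
  have f1 := fro_nonneg (x * A - A * x)
  have f2 := fro_nonneg (x * B - B * x)
  have g2 : fro (A * B - B * A) * fro x / (64 * (tq A + tq B + 1)) ≤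
      (fro (x * A - A * x) + fro (x * B - B * x)) / 16 := by
    rw [div_le_div_iff₀ (by positivity) (by norm_num)]
    nlinarith
  have e : -(fro (A * B - B * A) / (64 * (tq A + tq B + 1))) * fro x =
    - (fro (A * B - B * A) * fro x / (64 * (tq A + tq B + 1))) := by ring
  rw [e]
  linarith

lemma contractive_of_NC {m : ℕ} (L : Fin m → M2) (h : NC L) : HamIndepContractive L := by
  obtain ⟨c, hc, hg⟩ := gap L h
  intro H hH
  refine ⟨√2, c, by positivity, hc, ?_⟩
  intro s t hs hst ρ σ hρ hσ dρ dσ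
  set δ : ℝ → M2 := fun u => ρ u - σ u with hδ
  have hder : ∀ u, s ≤ u → ∀ i j, HasDerivAt (fun v => δ v i j) (driven H L u (δ u) i j) u := by
    intro u hu i j
    have := (hρ u hu i j).sub (hσ u hu i j)
    simp only [hδ, driven_sub]
    exact this
  have htr : ∀ u, s ≤ u → δ u 1 1 = - δ u 0 0 := by
    intro u hu
    have hd : ∀ v, s ≤ v → HasDerivAt (fun v => δ v 0 0 + δ v 1 1) 0 v := by
      intro v hv
      refine ((hder v hv 0 0).add (hder v hv 1 1)).congr_deriv ?_
      have := driven_trace H L v (δ v)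
      simpa [Matrix.trace, Fin.sum_univ_two] using this
    have hconst := constant_of_has_deriv_right_zero (f := fun v => δ v 0 0 + δ v 1 1) (a := s)
      (b := u) (fun v hv => (hd v hv.1).continuousAt.continuousWithinAt)
      (fun v hv => (hd v hv.1).hasDerivWithinAt) u ⟨hu, le_rfl⟩
    have h1 := dρ.2
    have h2 := dσ.2
    simp only [Matrix.trace, Fin.sum_univ_two, Matrix.diag_apply] at h1 h2
    simp only [hδ, Matrix.sub_apply] at hconst ⊢
    linear_combination hconst + h1 - h2
  have hanti : AntitoneOn (fun u => Real.exp (2 * c * (u - s)) * fro (δ u)) (Set.Ici s) := by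
    have hd : ∀ u, s ≤ u → HasDerivAt (fun u => Real.exp (2 * c * (u - s)) * fro (δ u))
        (Real.exp (2 * c * (u - s)) * (2 * c) * fro (δ u) +
          Real.exp (2 * c * (u - s)) * (2 * ip (δ u) (driven H L u (δ u)))) u := by
      intro u hu
      have h1 : HasDerivAt (fun u => Real.exp (2 * c * (u - s)))
          (Real.exp (2 * c * (u - s)) * (2 * c)) u := by
        have := (((hasDerivAt_id u).sub_const s).const_mul (2 * c)).exp
        simpa using this
      exact h1.mul (fro_deriv δ (fun u => driven H L u (δ u)) u (hder u hu))
    apply antitoneOn_of_deriv_nonpos (convex_Ici s)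
    · intro u hu
      exact (hd u hu).continuousAt.continuousWithinAt
    · intro u hu
      rw [interior_Ici] at hu
      exact (hd u hu.le).differentiableAt.differentiableWithinAt
    · intro u hu
      rw [interior_Ici] at hu
      rw [(hd u hu.le).deriv]
      have := hg (H u) (δ u) (hH.1 u) (htr u hu.le)
      have he := Real.exp_pos (2 * c * (u - s))
      change ip (δ u) (driven H L u (δ u)) ≤ _ at this
      nlinarith
  have hfin := hanti (Set.mem_Ici.2 le_rfl) (Set.mem_Ici.2 hst) hst
  simp only [sub_self, mul_zero, Real.exp_zero, one_mul] at hfin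
  have b1 := (traceNorm_bounds (δ t)).2
  have b2 := (traceNorm_bounds (δ s)).1
  change traceNorm (δ t) ≤ _ * traceNorm (δ s)
  apply le_of_sq_le_sq _ (mul_nonneg (by positivity) (traceNorm_nonneg _))
  have e1 : (√2 * Real.exp (-c * (t - s)) * traceNorm (δ s))^2 =
      2 * (Real.exp (-c * (t-s)) * Real.exp (-c * (t-s))) * traceNorm (δ s)^2 := by
    have : √2 ^ 2 = (2:ℝ) := Real.sq_sqrt (by norm_num)
    rw [mul_pow, mul_pow, this]; ring
  rw [e1, ← Real.exp_add]
  have e2 : Real.exp (-c * (t-s) + -c * (t-s)) * Real.exp (2 * c * (t - s)) = 1 := by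
    rw [← Real.exp_add, ← Real.exp_zero]; ring_nf
  set E := Real.exp (-c * (t-s) + -c * (t-s))
  have hE : 0 < E := Real.exp_pos _
  have : fro (δ t) ≤ E * fro (δ s) := by
    calc fro (δ t) = E * (Real.exp (2 * c * (t - s)) * fro (δ t)) := by
          rw [← mul_assoc, e2, one_mul]
      _ ≤ E * fro (δ s) := mul_le_mul_of_nonneg_left hfin hE.le
  nlinarith [mul_le_mul_of_nonneg_left b2 hE.le]

/-- A Hermitian traceless reflection commuting with all (normal) jump operators. -/
def Refl {m : ℕ} (L : Fin m → M2) : Prop :=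
  ∃ x : M2, xᴴ = x ∧ x.trace = 0 ∧ x * x = 1 ∧ ∀ j, x * L j = L j * x ∧ x * (L j)ᴴ = (L j)ᴴ * x ∧
    L j * (L j)ᴴ = (L j)ᴴ * L j

lemma herm_refl (A : M2) (hA : Aᴴ = A) (h : 0 < tq A) : ∃ x : M2, xᴴ = x ∧ x.trace = 0 ∧ x * x = 1 ∧
    ∀ B : M2, A * B = B * A → x * B = B * x := by
  obtain ⟨a1, a2, a3, a4⟩ := herm_coords hA
  set r := √(tq A) with hr
  have hr0 : 0 < r := Real.sqrt_pos.2 h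
  have hr2 : r ^ 2 = tq A := Real.sq_sqrt h.le
  refine ⟨((r⁻¹ : ℝ) : ℂ) • (A - (A.trace / 2) • (1 : M2)), ?_, ?_, ?_, ?_⟩
  · have ht : star A.trace = A.trace := by rw [← Matrix.trace_conjTranspose, hA]
    rw [Matrix.conjTranspose_smul, Matrix.conjTranspose_sub, Matrix.conjTranspose_smul, hA]
    simp only [Matrix.conjTranspose_one, star_div₀, ht]
    simp
  · simp [Matrix.trace_smul, Matrix.trace_sub]
  · have hsq : (A - (A.trace / 2) • (1 : M2)) * (A - (A.trace / 2) • (1 : M2)) = ((tq A : ℝ) : ℂ) • (1 : M2) := by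
      ext i j
      fin_cases i <;> fin_cases j <;> apply Complex.ext <;>
      simp [tq, Matrix.mul_apply, Matrix.trace, Fin.sum_univ_two, a1, a2, a3, a4, pow_two] <;> ring
    rw [Matrix.smul_mul, Matrix.mul_smul, hsq, smul_smul, smul_smul, ← hr2]
    have : ((r⁻¹ : ℝ) : ℂ) * (((r⁻¹ : ℝ) : ℂ) * ((r^2 : ℝ) : ℂ)) = 1 := by
      rw [← Complex.ofReal_mul, ← Complex.ofReal_mul, ← Complex.ofReal_one]
      congr 1
      field_simp
    rw [mul_assoc, this, one_smul]
  · intro B hB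
    simp only [Matrix.smul_mul, Matrix.mul_smul, Matrix.sub_mul, Matrix.mul_sub, hB, one_mul, mul_one]

lemma refl_of_not_NC {m : ℕ} (L : Fin m → M2) (h : ¬ NC L) : Refl L := by
  have hc : ∀ j b k c, hp b (L j) * hp c (L k) = hp c (L k) * hp b (L j) := by
    intro j b k c
    by_contra hne
    exact h ⟨j, b, k, c, hne⟩
  have hnorm : ∀ j, L j * (L j)ᴴ = (L j)ᴴ * L j := by
    intro j
    have e := hc j true j false
    have cc : Commute (hp true (L j)) (hp false (L j)) := e
    have key : Commute ((1/2 : ℂ) • hp true (L j) - (Complex.I/2) • hp false (L j))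
        ((1/2 : ℂ) • hp true (L j) + (Complex.I/2) • hp false (L j)) := by
      have ct : Commute ((1/2 : ℂ) • hp true (L j)) ((Complex.I/2) • hp false (L j)) :=
        (cc.smul_left _).smul_right _
      exact ((Commute.refl _).add_right ct).sub_left (ct.symm.add_right (Commute.refl _))
    rw [← hp_rec, ← hp_rec'] at key
    exact key
  have hx : ∃ x : M2, xᴴ = x ∧ x.trace = 0 ∧ x * x = 1 ∧ ∀ k c, x * hp c (L k) = hp c (L k) * x := by
    by_cases hex : ∃ j b, 0 < tq (hp b (L j))
    · obtain ⟨j, b, hjb⟩ := hex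
      obtain ⟨x, h1, h2, h3, h4⟩ := herm_refl _ (hp_herm b (L j)) hjb
      exact ⟨x, h1, h2, h3, fun k c => h4 _ (hc j b k c)⟩
    · push Not at hex
      refine ⟨!![1, 0; 0, -1], ?_, ?_, ?_, ?_⟩
      · ext i j; fin_cases i <;> fin_cases j <;> simp
      · simp [Matrix.trace, Fin.sum_univ_two]
      · ext i j; fin_cases i <;> fin_cases j <;> simp
      · intro k c
        have h0 := hex k c
        obtain ⟨a1, a2, a3, a4⟩ := herm_coords (hp_herm c (L k))
        set A := hp c (L k)
        unfold tq at h0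
        have z1 : (A 0 1).re = 0 := by
          apply pow_eq_zero_iff (two_ne_zero) |>.1
          nlinarith [sq_nonneg (A 0 1).re, sq_nonneg (A 0 1).im, sq_nonneg (((A 0 0).re - (A 1 1).re)/2)]
        have z2 : (A 0 1).im = 0 := by
          apply pow_eq_zero_iff (two_ne_zero) |>.1
          nlinarith [sq_nonneg (A 0 1).re, sq_nonneg (A 0 1).im, sq_nonneg (((A 0 0).re - (A 1 1).re)/2)]
        have y1 : A 0 1 = 0 := Complex.ext z1 z2
        have y2 : A 1 0 = 0 := Complex.ext (by simp [a3, z1]) (by simp [a4, z2])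
        ext i j; fin_cases i <;> fin_cases j <;> simp [Matrix.mul_apply, Fin.sum_univ_two, y1, y2]
  obtain ⟨x, h1, h2, h3, h4⟩ := hx
  refine ⟨x, h1, h2, h3, fun j => ⟨?_, ?_, hnorm j⟩⟩
  · rw [hp_rec (L j)]
    simp only [Matrix.mul_sub, Matrix.sub_mul, Matrix.smul_mul, Matrix.mul_smul, h4]
  · rw [hp_rec' (L j)]
    simp only [Matrix.mul_add, Matrix.add_mul, Matrix.smul_mul, Matrix.mul_smul, h4]

lemma not_contractive {m : ℕ} (L : Fin m → M2) (h : Refl L) :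
    ¬ ExpContractive fun _ x => totalDissipator L x := by
  obtain ⟨x, hx, htr, hsq, hj⟩ := h
  rintro ⟨K, γ, hK, hγ, hcon⟩
  have hcom : ∀ y : M2, (∀ j, y * L j = L j * y) → (∀ j, y * (L j)ᴴ = (L j)ᴴ * y) →
      totalDissipator L y = 0 := by
    intro y hy hy'
    unfold totalDissipator
    apply Finset.sum_eq_zero
    intro j _
    unfold dissipator
    have e1 : L j * y * (L j)ᴴ = y * ((L j)ᴴ * L j) := by
      rw [← hy j, mul_assoc, (hj j).2.2]
    have e2 : (L j)ᴴ * L j * y = y * ((L j)ᴴ * L j) := by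
      rw [mul_assoc, ← hy j, ← mul_assoc, ← hy' j, mul_assoc]
    rw [e1, e2, ← two_smul ℂ (y * _), smul_smul]
    norm_num
  have hP : ∀ ε : ℂ, star ε = ε → ε * ε = 1 → IsDensity ((1/2 : ℂ) • ((1 : M2) + ε • x)) ∧
      IsSolution (fun _ x => totalDissipator L x) 0 (fun _ => (1/2 : ℂ) • ((1 : M2) + ε • x)) := by
    intro ε he he2
    refine ⟨⟨?_, ?_⟩, ?_⟩
    · have hh : ((1/2 : ℂ) • ((1 : M2) + ε • x))ᴴ = (1/2 : ℂ) • ((1 : M2) + ε • x) := by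
        simp only [Matrix.conjTranspose_smul, Matrix.conjTranspose_add, hx, he, Matrix.conjTranspose_one]
        simp
      have hid : (1/2 : ℂ) • ((1 : M2) + ε • x) =
          ((1/2 : ℂ) • ((1 : M2) + ε • x))ᴴ * ((1/2 : ℂ) • ((1 : M2) + ε • x)) := by
        rw [hh]
        simp only [Matrix.smul_mul, Matrix.mul_smul, Matrix.add_mul, Matrix.mul_add, one_mul, mul_one, hsq,
          smul_smul]
        have e4 : (1/2 : ℂ) = 1/4 + ε * ε * (1/4) := by rw [he2]; norm_num
        match_scalars
        · linear_combination e4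
        · ring
      rw [hid]
      exact Matrix.posSemidef_conjTranspose_mul_self _
    · simp [Matrix.trace_smul, Matrix.trace_add, htr]
    · intro t _ i j
      simp only
      rw [hcom]
      · simpa using hasDerivAt_const t _
      · intro j
        simp only [Matrix.smul_mul, Matrix.mul_smul, Matrix.add_mul, Matrix.mul_add, one_mul, mul_one,
          (hj j).1]
      · intro j
        simp only [Matrix.smul_mul, Matrix.mul_smul, Matrix.add_mul, Matrix.mul_add, one_mul, mul_one,
          (hj j).2.1]
  obtain ⟨d1, s1⟩ := hP 1 (by simp) (by simp)
  obtain ⟨d2, s2⟩ := hP (-1) (by simp) (by simp)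
  have hbd : ∀ t : ℝ, 0 ≤ t → _ := fun t ht => hcon 0 t le_rfl ht _ _ s1 s2 d1 d2
  have hdiff : (1/2 : ℂ) • ((1 : M2) + (1 : ℂ) • x) - (1/2 : ℂ) • ((1 : M2) + (-1 : ℂ) • x) = x := by
    module
  simp only [hdiff, sub_zero] at hbd
  have hpos : 0 < traceNorm x := by
    rcases (traceNorm_nonneg x).lt_or_eq with h | h
    · exact h
    · have := (traceNorm_bounds x).1
      rw [← h] at this
      have hx0 : x = 0 := fro_eq_zero (le_antisymm (by simpa using this) (fro_nonneg x))
      rw [hx0] at hsq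
      simp at hsq
  have hone : ∀ t : ℝ, 0 ≤ t → 1 ≤ K * Real.exp (-γ * t) := by
    intro t ht
    have := hbd t ht
    by_contra hlt
    push Not at hlt
    nlinarith
  have hlim : Filter.Tendsto (fun t : ℝ => K * Real.exp (-γ * t)) Filter.atTop (nhds (K * 0)) := by
    apply Filter.Tendsto.const_mul
    apply Real.tendsto_exp_atBot.comp
    exact Filter.Tendsto.const_mul_atTop_of_neg (by linarith) Filter.tendsto_id
  have := ge_of_tendsto hlim (Filter.eventually_atTop.2 ⟨0, fun t ht => hone t ht⟩)
  simp at this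
  linarith

lemma not_adjoin {m : ℕ} (L : Fin m → M2) (h : Refl L) :
    NonUnitalAlgebra.adjoin ℂ (Set.range L ∪ Set.range fun j => (L j)ᴴ) ≠ ⊤ := by
  obtain ⟨x, hx, htr, hsq, hj⟩ := h
  intro htop
  have hle : NonUnitalAlgebra.adjoin ℂ (Set.range L ∪ Set.range fun j => (L j)ᴴ) ≤
      NonUnitalSubalgebra.centralizer ℂ {x} := by
    apply NonUnitalAlgebra.adjoin_le
    rintro y (⟨j, rfl⟩ | ⟨j, rfl⟩)
    · intro z hz
      rw [Set.mem_singleton_iff.1 hz]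
      exact (hj j).1
    · intro z hz
      rw [Set.mem_singleton_iff.1 hz]
      exact (hj j).2.1
  rw [htop] at hle
  have hall : ∀ y : M2, x * y = y * x := fun y => hle (NonUnitalAlgebra.mem_top) x rfl
  have h1 := hall !![0, 1; 0, 0]
  have h2 := hall !![0, 0; 1, 0]
  have a := congrFun (congrFun h1 0) 0
  have b := congrFun (congrFun h1 0) 1
  have c := congrFun (congrFun h2 0) 0
  have d := congrFun (congrFun hsq 0) 0
  simp [Matrix.mul_apply, Fin.sum_univ_two, Matrix.trace] at a b c d htr
  have : x 0 0 = 0 := by linear_combination (1/2) * htr + (1/2) * b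
  simp [this, ← a, c] at d

lemma not_iv {m : ℕ} (L : Fin m → M2) (h : ¬ NC L) : ¬ ((∃ j, L j * (L j)ᴴ ≠ (L j)ᴴ * L j) ∨
       (∃ j k, L j * L k ≠ L k * L j)) := by
  have hc : ∀ j b k c, hp b (L j) * hp c (L k) = hp c (L k) * hp b (L j) := by
    intro j b k c
    by_contra hne
    exact h ⟨j, b, k, c, hne⟩
  rintro (⟨j, hj⟩ | ⟨j, k, hjk⟩)
  · obtain ⟨x, -, -, -, hx⟩ := refl_of_not_NC L h
    exact hj (hx j).2.2
  · apply hjk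
    have cc : ∀ b c, Commute (hp b (L j)) (hp c (L k)) := fun b c => hc j b k c
    have key : Commute ((1/2 : ℂ) • hp true (L j) - (Complex.I/2) • hp false (L j))
        ((1/2 : ℂ) • hp true (L k) - (Complex.I/2) • hp false (L k)) :=
      ((((cc _ _).smul_left _).smul_right _).sub_right (((cc _ _).smul_left _).smul_right _)).sub_left
        ((((cc _ _).smul_left _).smul_right _).sub_right (((cc _ _).smul_left _).smul_right _))
    rw [← hp_rec, ← hp_rec] at key
    exact key

/-- Fuglede in dimension two. -/
lemma fuglede (A B : M2) (hA : A * Aᴴ = Aᴴ * A) (hAB : A * B = B * A) : Aᴴ * B = B * Aᴴ := by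
  by_cases hsc : A 0 1 = 0 ∧ A 1 0 = 0 ∧ A 0 0 = A 1 1
  · obtain ⟨h1, h2, h3⟩ := hsc
    ext i j
    fin_cases i <;> fin_cases j <;>
      simp [Matrix.mul_apply, Fin.sum_univ_two, h1, h2, h3, mul_comm]
  · have e00 := congrFun (congrFun hAB 0) 0
    have e01 := congrFun (congrFun hAB 0) 1
    have e10 := congrFun (congrFun hAB 1) 0
    simp only [Matrix.mul_apply, Fin.sum_univ_two] at e00 e01 e10
    have hB : ∃ α β : ℂ, B = α • (1 : M2) + β • A := by
      by_cases h1 : A 0 1 = 0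
      · by_cases h2 : A 1 0 = 0
        · have h3 : A 0 0 - A 1 1 ≠ 0 := fun h => hsc ⟨h1, h2, sub_eq_zero.1 h⟩
          have b01 : B 0 1 = 0 := by
            apply mul_left_cancel₀ h3
            linear_combination e01 + (B 0 0 - B 1 1) * h1
          have b10 : B 1 0 = 0 := by
            apply mul_left_cancel₀ h3
            linear_combination -e10 + (B 0 0 - B 1 1) * h2
          refine ⟨B 0 0 - (B 0 0 - B 1 1) / (A 0 0 - A 1 1) * A 0 0,
            (B 0 0 - B 1 1) / (A 0 0 - A 1 1), ?_⟩
          ext i j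
          fin_cases i <;> fin_cases j <;> simp [h1, h2, b01, b10]
          field_simp
          ring
        · refine ⟨B 0 0 - B 1 0 / A 1 0 * A 0 0, B 1 0 / A 1 0, ?_⟩
          ext i j
          fin_cases i <;> fin_cases j <;> simp [h2] <;> field_simp
          · linear_combination -e00
          · linear_combination -e10
      · refine ⟨B 0 0 - B 0 1 / A 0 1 * A 0 0, B 0 1 / A 0 1, ?_⟩
        ext i j
        fin_cases i <;> fin_cases j <;> simp [h1] <;> field_simp
        · linear_combination e00
        · linear_combination e01
    obtain ⟨α, β, rfl⟩ := hB
    simp only [Matrix.mul_add, Matrix.add_mul, Matrix.smul_mul, Matrix.mul_smul, hA, one_mul, mul_one]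

lemma iv_of_NC {m : ℕ} (L : Fin m → M2) (h : NC L) : ((∃ j, L j * (L j)ᴴ ≠ (L j)ᴴ * L j) ∨
       (∃ j k, L j * L k ≠ L k * L j)) := by
  by_contra hn
  push Not at hn
  obtain ⟨hn1, hn2⟩ := hn
  obtain ⟨j, b, k, c, hne⟩ := h
  apply hne
  have c1 : Commute (L j) (L k) := hn2 j k
  have c2 : Commute (L j)ᴴ (L k) := fuglede _ _ (hn1 j) (hn2 j k)
  have c3 : Commute (L j) (L k)ᴴ := (fuglede _ _ (hn1 k) (hn2 k j)).symm
  have c4 : Commute (L j)ᴴ (L k)ᴴ := by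
    have := congrArg Matrix.conjTranspose (hn2 j k)
    rw [Matrix.conjTranspose_mul, Matrix.conjTranspose_mul] at this
    exact this.symm
  change Commute _ _
  cases b <;> cases c <;> simp only [hp, if_true, if_false, Bool.false_eq_true]
  · exact (((c1.sub_right c3).sub_left (c2.sub_right c4)).smul_left _).smul_right _
  · exact ((c1.add_right c3).sub_left (c2.add_right c4)).smul_left _
  · exact ((c1.sub_right c3).add_left (c2.sub_right c4)).smul_right _
  · exact (c1.add_right c3).add_left (c2.add_right c4)

lemma expansion (A B X : M2) :
    ((-1/8) * ((A * B - B * A) * (A * B - B * A)).trace) • (X - (X.trace / 2) • (1 : M2)) =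
    ((((X * A).trace - X.trace * A.trace / 2) * ((B * B).trace - B.trace * B.trace / 2)
     - ((X * B).trace - X.trace * B.trace / 2) * ((A * B).trace - A.trace * B.trace / 2)) / 4) •
        (A - (A.trace / 2) • (1 : M2)) +
    ((((X * B).trace - X.trace * B.trace / 2) * ((A * A).trace - A.trace * A.trace / 2)
     - ((X * A).trace - X.trace * A.trace / 2) * ((A * B).trace - A.trace * B.trace / 2)) / 4) •
        (B - (B.trace / 2) • (1 : M2)) +
    ((-1/8) * (X * (A * B - B * A)).trace) • (A * B - B * A) := by
  ext i j
  fin_cases i <;> fin_cases j <;>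
    simp [Matrix.mul_apply, Matrix.trace, Fin.sum_univ_two] <;> ring

lemma comm_sq (A B : M2) : (A * B - B * A) * (A * B - B * A) =
    (((A * B - B * A) * (A * B - B * A)).trace / 2) • (1 : M2) := by
  ext i j
  fin_cases i <;> fin_cases j <;>
    simp [Matrix.mul_apply, Matrix.trace, Fin.sum_univ_two] <;> ring

lemma pair_generates (S : NonUnitalSubalgebra ℂ M2) (A B : M2) (hA : Aᴴ = A) (hB : Bᴴ = B)
    (mA : A ∈ S) (mB : B ∈ S) (hne : A * B ≠ B * A) : S = ⊤ := by
  have mC : A * B - B * A ∈ S := sub_mem (mul_mem mA mB) (mul_mem mB mA)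
  have hCs : (A * B - B * A)ᴴ = -(A * B - B * A) := by
    rw [Matrix.conjTranspose_sub, Matrix.conjTranspose_mul, Matrix.conjTranspose_mul, hA, hB]
    abel
  have htr : ((A * B - B * A) * (A * B - B * A)).trace ≠ 0 := by
    intro h
    have h2 : ((A * B - B * A)ᴴ * (A * B - B * A)).trace = 0 := by
      rw [hCs, Matrix.neg_mul, Matrix.trace_neg, h, neg_zero]
    exact hne (sub_eq_zero.1 (Matrix.trace_conjTranspose_mul_self_eq_zero_iff.1 h2))
  have hsq := comm_sq A B
  have m1 : (1 : M2) ∈ S := by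
    have e : (1 : M2) = (((A * B - B * A) * (A * B - B * A)).trace / 2)⁻¹ •
        ((A * B - B * A) * (A * B - B * A)) := by
      conv_rhs => rw [hsq]
      rw [Matrix.trace_smul, smul_smul]
      simp only [Matrix.trace_one, Fintype.card_fin, smul_eq_mul]
      have : ((((A * B - B * A) * (A * B - B * A)).trace / 2 * ((2:ℕ) : ℂ)) / 2)⁻¹ *
        (((A * B - B * A) * (A * B - B * A)).trace / 2) = 1 := by
        push_cast
        field_simp
      rw [this, one_smul]
    rw [e]
    exact SMulMemClass.smul_mem _ (mul_mem mC mC)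
  rw [eq_top_iff]
  intro X _
  have hex := expansion A B X
  set T := ((A * B - B * A) * (A * B - B * A)).trace
  have hT : (-1/8 : ℂ) * T ≠ 0 := mul_ne_zero (by norm_num) htr
  have mR : ((-1/8 : ℂ) * T) • (X - (X.trace / 2) • (1 : M2)) ∈ S := by
    rw [hex]
    exact add_mem (add_mem (SMulMemClass.smul_mem _ (sub_mem mA (SMulMemClass.smul_mem _ m1)))
      (SMulMemClass.smul_mem _ (sub_mem mB (SMulMemClass.smul_mem _ m1))))
      (SMulMemClass.smul_mem _ mC)
  have m3 : X - (X.trace / 2) • (1 : M2) ∈ S := by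
    have := SMulMemClass.smul_mem ((-1/8 : ℂ) * T)⁻¹ mR
    rwa [smul_smul, inv_mul_cancel₀ hT, one_smul] at this
  have := add_mem m3 (SMulMemClass.smul_mem (X.trace / 2) m1)
  simpa using this

lemma adjoin_of_NC {m : ℕ} (L : Fin m → M2) (h : NC L) :
    NonUnitalAlgebra.adjoin ℂ (Set.range L ∪ Set.range fun j => (L j)ᴴ) = ⊤ := by
  obtain ⟨j, b, k, c, hne⟩ := h
  have hm : ∀ j b, hp b (L j) ∈
      NonUnitalAlgebra.adjoin ℂ (Set.range L ∪ Set.range fun j => (L j)ᴴ) := by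
    intro j b
    have m1 : L j ∈ NonUnitalAlgebra.adjoin ℂ (Set.range L ∪ Set.range fun j => (L j)ᴴ) :=
      NonUnitalAlgebra.subset_adjoin ℂ (Or.inl ⟨j, rfl⟩)
    have m2 : (L j)ᴴ ∈ NonUnitalAlgebra.adjoin ℂ (Set.range L ∪ Set.range fun j => (L j)ᴴ) :=
      NonUnitalAlgebra.subset_adjoin ℂ (Or.inr ⟨j, rfl⟩)
    cases b
    · simp only [hp, Bool.false_eq_true, if_false]
      exact SMulMemClass.smul_mem _ (sub_mem m1 m2)
    · simp only [hp, if_true]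
      exact add_mem m1 m2
  exact pair_generates _ _ _ (hp_herm _ _) (hp_herm _ _) (hm j b) (hm k c) hne

theorem qubit_dissipator_tfae {m : ℕ} (L : Fin m → Matrix (Fin 2) (Fin 2) ℂ) :
    (HamIndepContractive L ↔
      ExpContractive fun _ x => totalDissipator L x) ∧
    ((ExpContractive fun _ x => totalDissipator L x) ↔
      NonUnitalAlgebra.adjoin ℂ
        (Set.range L ∪ Set.range fun j => (L j)ᴴ) = ⊤) ∧
    ((NonUnitalAlgebra.adjoin ℂ
        (Set.range L ∪ Set.range fun j => (L j)ᴴ) = ⊤) ↔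
      ((∃ j, L j * (L j)ᴴ ≠ (L j)ᴴ * L j) ∨
       (∃ j k, L j * L k ≠ L k * L j))) := by
  have h12 : HamIndepContractive L → ExpContractive fun _ x => totalDissipator L x := by
    intro h
    have := h (fun _ => 0) ⟨fun _ => Matrix.isHermitian_zero, fun i j => by
      simpa using continuous_const⟩
    have e : driven (fun _ => 0) L = fun _ x => totalDissipator L x := by
      funext t x
      simp [driven, hamTerm]
    rwa [e] at this
  by_cases h : NC L
  · have h1 := contractive_of_NC L h
    have h2 := h12 h1
    have h3 := adjoin_of_NC L h
    have h4 := iv_of_NC L h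
    exact ⟨iff_of_true h1 h2, iff_of_true h2 h3, iff_of_true h3 h4⟩
  · have hR := refl_of_not_NC L h
    have h2 := not_contractive L hR
    have h3 := not_adjoin L hR
    have h4 := not_iv L h
    exact ⟨iff_of_false (fun h => h2 (h12 h)) h2, iff_of_false h2 h3, iff_of_false h3 h4⟩

end Paper
end

section
/- Let D = Σ_j D_{L_j} be an arbitrary total dissipator on M_3(ℂ). If the set {L_j : j} alone generates the full complex matrix algebra M_3(ℂ) (the smallest subset containing it and closed under addition, complex scalar multiplication and matrix multiplication is M_3(ℂ)), then D is Hamiltonian-independently contractive. Conversely, if D is Hamiltonian-independently contractive, then the set {L_j, L_j† : j} generates the full complex matrix algebra M_3(ℂ). -/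
open scoped ComplexOrder Kronecker
open Matrix

namespace Paper
abbrev M3 := Matrix (Fin 3) (Fin 3) ℂ

structure Good (X S : M3) : Prop where
  h : Sᴴ = S
  sq : S * S = 1
  comm : S * X = X * S
  pos : (S * X).PosSemidef

lemma exists_good (X : M3) (hX : X.IsHermitian) : ∃ S, Good X S := by
  set U : M3 := (hX.eigenvectorUnitary : M3) with hU
  have hUU : Uᴴ * U = 1 := by
    simpa [star_eq_conjTranspose] using (Unitary.mem_iff.1 hX.eigenvectorUnitary.2).1
  have hUU' : U * Uᴴ = 1 := by
    simpa [star_eq_conjTranspose] using (Unitary.mem_iff.1 hX.eigenvectorUnitary.2).2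
  set l := hX.eigenvalues
  have hs : X = U * diagonal (fun i => ((l i : ℝ) : ℂ)) * Uᴴ := by
    have := hX.spectral_theorem
    rw [Unitary.conjStarAlgAut_apply] at this
    exact this
  set s : Fin 3 → ℂ := fun i => if 0 ≤ l i then 1 else -1
  have key : ∀ a b : Fin 3 → ℂ, (U * diagonal a * Uᴴ) * (U * diagonal b * Uᴴ)
      = U * diagonal (fun i => a i * b i) * Uᴴ := by
    intro a b
    calc _ = U * diagonal a * (Uᴴ * U) * diagonal b * Uᴴ := by noncomm_ring
      _ = _ := by rw [hUU, Matrix.mul_one, Matrix.mul_assoc U, diagonal_mul_diagonal]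
  have hss : ∀ i, star (s i) = s i := by intro i; simp only [s]; split_ifs <;> simp
  have hss2 : ∀ i, s i * s i = 1 := by intro i; simp only [s]; split_ifs <;> simp
  refine ⟨U * diagonal s * Uᴴ, ?_, ?_, ?_, ?_⟩
  · rw [conjTranspose_mul, conjTranspose_mul, diagonal_conjTranspose, conjTranspose_conjTranspose,
      Matrix.mul_assoc]
    congr 3
    funext i; exact hss i
  · rw [key]; simp only [hss2]
    rw [show (diagonal fun _ : Fin 3 => (1:ℂ)) = 1 from diagonal_one, Matrix.mul_one, hUU']
  · rw [hs, key, key]; simp only [mul_comm]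
  · rw [hs, key]
    apply PosSemidef.mul_mul_conjTranspose_same
    apply PosSemidef.diagonal
    intro i
    simp only [s, Pi.zero_apply]
    split_ifs with h
    · rw [one_mul]; exact_mod_cast h
    · push Not at h
      rw [neg_one_mul]
      exact_mod_cast (neg_pos.2 h).le

lemma good_max {X S T : M3} (g : Good X S) (hT : Tᴴ = T) (hT2 : T * T = 1) :
    (trace (T * X)).re ≤ (trace (S * X)).re := by
  set A := S * X with hA
  have hX : X = S * A := by rw [hA, ← Matrix.mul_assoc, g.sq, Matrix.one_mul]
  have h0 : 0 ≤ (trace ((1 - T * S) * A * (1 - T * S)ᴴ)).re := 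
    (Complex.le_def.1 (g.pos.mul_mul_conjTranspose_same (1 - T * S)).trace_nonneg).1
  have e1 : (1 - T * S)ᴴ = 1 - S * T := by
    rw [conjTranspose_sub, conjTranspose_mul, hT, g.h, conjTranspose_one]
  have e2 : trace ((1 - T * S) * A * (1 - T * S)ᴴ) = 2 * trace A - trace (T * X) - trace (A * S * T) := by
    have hh : (1 - S * T) * (1 - T * S) = 2 • (1:M3) - T * S - S * T := by
      have : S * T * (T * S) = 1 := by
        calc _ = S * (T * T) * S := by noncomm_ring
          _ = 1 := by rw [hT2, Matrix.mul_one, g.sq]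
      calc _ = 1 - T * S - S * T + S * T * (T * S) := by noncomm_ring
        _ = _ := by rw [this]; noncomm_ring
    rw [e1, trace_mul_comm, ← Matrix.mul_assoc, hh, hX, Matrix.mul_assoc A, trace_mul_comm A]
    simp only [Matrix.sub_mul, trace_sub, ← Matrix.mul_assoc]
    simp [two_mul, two_smul, Matrix.add_mul]
  have e3 : trace (A * S * T) = star (trace (T * X)) := by
    rw [← trace_conjTranspose, conjTranspose_mul, hT, hX, conjTranspose_mul, g.h, 
      g.pos.isHermitian.eq]
  rw [e2, e3] at h0
  simp at h0
  linarith

open scoped MatrixOrder Matrix.Norms.L2Operator in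
lemma psd_mul_zero {A B : M3} (hA : A.PosSemidef) (h : (trace (B * A * Bᴴ)).re ≤ 0) : B * A = 0 := by
  have hp := hA.mul_mul_conjTranspose_same B
  obtain ⟨C, rfl⟩ := CStarAlgebra.nonneg_iff_eq_star_mul_self.1 hA.nonneg
  rw [star_eq_conjTranspose] at *
  have h1 : trace ((B * Cᴴ) * (B * Cᴴ)ᴴ) = 0 := by
    have e : (B * Cᴴ) * (B * Cᴴ)ᴴ = B * (Cᴴ * C) * Bᴴ := by
      rw [conjTranspose_mul, conjTranspose_conjTranspose]; noncomm_ring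
    rw [e]
    have := Complex.le_def.1 hp.trace_nonneg
    apply Complex.ext
    · exact le_antisymm h this.1
    · exact this.2.symm
  rw [trace_mul_conjTranspose_self_eq_zero_iff] at h1
  rw [← Matrix.mul_assoc, h1, Matrix.zero_mul]

lemma good_pos {X S : M3} (g : Good X S) (hX : X ≠ 0) : 0 < (trace (S * X)).re := by
  by_contra h
  push Not at h
  have := psd_mul_zero (B := 1) g.pos (by simpa using h)
  apply hX
  calc X = S * (S * X) := by rw [← Matrix.mul_assoc, g.sq, Matrix.one_mul]
    _ = 0 := by rw [Matrix.one_mul] at this; rw [this, Matrix.mul_zero]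

end Paper

namespace Paper

lemma diss_trace (L X S P Q : M3) (g : Good X S) (hP : P = ((1:ℂ)/2) • (1 + S))
    (hQ : Q = ((1:ℂ)/2) • (1 - S)) :
    trace (S * dissipator L X) =
      -2 * (trace (Q * L * (P * (S * X) * P) * (Q * L)ᴴ)
        + trace (P * L * (Q * (S * X) * Q) * (P * L)ᴴ)) := by
  have hPP : P * P = P := by
    rw [hP]; simp only [smul_mul_smul_comm, Matrix.add_mul, Matrix.mul_add, g.sq, Matrix.one_mul, Matrix.mul_one]
    module
  have hQQ : Q * Q = Q := by
    rw [hQ]; simp only [smul_mul_smul_comm, Matrix.sub_mul, Matrix.mul_sub, g.sq, Matrix.one_mul, Matrix.mul_one]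
    module
  have hPh : Pᴴ = P := by
    rw [hP, conjTranspose_smul, conjTranspose_add, conjTranspose_one, g.h]; simp
  have hQh : Qᴴ = Q := by
    rw [hQ, conjTranspose_smul, conjTranspose_sub, conjTranspose_one, g.h]; simp
  set A := S * X with hA
  have hSA : S * A = A * S := by
    rw [hA, Matrix.mul_assoc, g.comm]
  have hX : X = S * A := by rw [hA, ← Matrix.mul_assoc, g.sq, Matrix.one_mul]
  have hAP : A * P = P * A := by
    rw [hP, Matrix.mul_smul, Matrix.smul_mul, Matrix.mul_add, Matrix.add_mul, hSA]; simp
  have hAQ : A * Q = Q * A := by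
    rw [hQ, Matrix.mul_smul, Matrix.smul_mul, Matrix.mul_sub, Matrix.sub_mul, hSA]; simp
  have t1 : trace (Q * L * (P * A * P) * (Q * L)ᴴ) = trace (Q * L * P * A * Lᴴ) := by
    rw [Matrix.mul_assoc P, hAP, ← Matrix.mul_assoc P, hPP, conjTranspose_mul, hQh,
      ← Matrix.mul_assoc, trace_mul_comm]
    simp only [← Matrix.mul_assoc, hQQ]
  have t2 : trace (P * L * (Q * A * Q) * (P * L)ᴴ) = trace (P * L * Q * A * Lᴴ) := by
    rw [Matrix.mul_assoc Q, hAQ, ← Matrix.mul_assoc Q, hQQ, conjTranspose_mul, hPh,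
      ← Matrix.mul_assoc, trace_mul_comm]
    simp only [← Matrix.mul_assoc, hPP]
  have hsum : Q * L * P + P * L * Q = ((1:ℂ)/2) • (L - S * L * S) := by
    rw [hP, hQ]
    simp only [Matrix.smul_mul, Matrix.mul_smul, smul_smul, Matrix.sub_mul, Matrix.mul_sub,
      Matrix.add_mul, Matrix.mul_add, Matrix.one_mul, Matrix.mul_one]
    module
  rw [t1, t2, ← trace_add, ← Matrix.add_mul, ← Matrix.add_mul, hsum]
  have u1 : trace (S * (Lᴴ * L * X)) = trace (L * A * Lᴴ) := by
    rw [trace_mul_comm, Matrix.mul_assoc _ X, ← g.comm, ← hA, trace_mul_comm (L * A)]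
    simp only [← Matrix.mul_assoc]
  have u2 : trace (S * (X * (Lᴴ * L))) = trace (L * A * Lᴴ) := by
    rw [← Matrix.mul_assoc, ← hA, trace_mul_comm, trace_mul_comm (L * A)]
    simp only [← Matrix.mul_assoc]
  have u3 : trace (S * (L * X * Lᴴ)) = trace (S * L * S * A * Lᴴ) := by
    rw [hX]; simp only [← Matrix.mul_assoc]
  rw [dissipator, Matrix.mul_sub, Matrix.mul_smul, Matrix.mul_add, trace_sub, trace_smul, trace_add,
    u1, u2, u3]
  simp only [Matrix.smul_mul, trace_smul, Matrix.sub_mul, trace_sub, smul_eq_mul]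
  ring

/-- If `P` is idempotent-like and `L` generate, no off-diagonal vanishing. -/
lemma adjoin_contra {m : ℕ} {L : Fin m → M3} (hL : NonUnitalAlgebra.adjoin ℂ (Set.range L) = ⊤)
    {P Q : M3} (hPQ : P + Q = 1) (h : ∀ j, P * L j * Q = 0) (hPQ0 : P * Q = 0) :
    ∀ M : M3, P * M * Q = 0 := by
  intro M
  have hM : M ∈ NonUnitalAlgebra.adjoin ℂ (Set.range L) := by rw [hL]; trivial
  induction hM using NonUnitalAlgebra.adjoin_induction with
  | mem x hx => obtain ⟨j, rfl⟩ := hx; exact h j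
  | add x y _ _ hx hy => rw [Matrix.mul_add, Matrix.add_mul, hx, hy, add_zero]
  | zero => simp
  | mul x y _ _ hx hy =>
    calc P * (x * y) * Q = P * x * 1 * y * Q := by noncomm_ring
      _ = P * x * P * y * Q + P * x * Q * y * Q := by rw [← hPQ]; noncomm_ring
      _ = P * x * (P * y * Q) + (P * x * Q) * y * Q := by noncomm_ring
      _ = 0 := by rw [hx, hy]; simp
  | smul r x _ hx => rw [Matrix.mul_smul, Matrix.smul_mul, hx, smul_zero]

lemma zero_of_forall {P Q : M3} (h : ∀ M : M3, P * M * Q = 0) : P = 0 ∨ Q = 0 := by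
  by_contra hc
  push Not at hc
  obtain ⟨hP, hQ⟩ := hc
  obtain ⟨i, j, hij⟩ : ∃ i j, P i j ≠ 0 := by
    by_contra hh; push Not at hh; exact hP (by ext i j; exact hh i j)
  obtain ⟨k, l, hkl⟩ : ∃ i j, Q i j ≠ 0 := by
    by_contra hh; push Not at hh; exact hQ (by ext i j; exact hh i j)
  have := congrFun (congrFun (h (Matrix.single j k 1)) i) l
  rw [Matrix.mul_assoc, Matrix.mul_apply] at this
  rw [Finset.sum_eq_single j] at this
  · rw [Matrix.single_mul_apply_same] at this
    simp at this
    tauto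
  · intro b _ hb
    rw [Matrix.single_mul_apply_of_ne _ _ _ _ _ hb]; simp
  · simp

/-- rank one transfer -/
lemma rank_one_transfer {Q Y B : M3} (hQ : Q.rank ≤ 1) (hY : Y ≠ 0) (hQY : Q * Y = Y)
    (h : B * Y = 0) : B * Q = 0 := by
  have hle : LinearMap.range Y.mulVecLin ≤ LinearMap.range Q.mulVecLin := by
    rw [← hQY, Matrix.mulVecLin_mul]
    exact LinearMap.range_comp_le_range _ _
  have hYr : 1 ≤ Module.finrank ℂ (LinearMap.range Y.mulVecLin) := by
    rw [Nat.one_le_iff_ne_zero]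
    intro h0
    rw [Submodule.finrank_eq_zero, LinearMap.range_eq_bot] at h0
    apply hY
    apply Matrix.toLin'.injective
    rw [Matrix.toLin'_apply', h0, map_zero]
  have heq := Submodule.eq_of_le_of_finrank_le hle (le_trans hQ hYr)
  apply Matrix.toLin'.injective
  rw [Matrix.toLin'_apply', map_zero]
  ext1 v
  ext1
  rw [Matrix.mulVecLin_mul]
  simp only [LinearMap.comp_apply]
  have : ∀ w ∈ LinearMap.range Q.mulVecLin, B.mulVecLin w = 0 := by
    rw [← heq]
    rintro w ⟨u, rfl⟩
    rw [← LinearMap.comp_apply, ← Matrix.mulVecLin_mul, h]; simp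
  rw [this _ ⟨_, rfl⟩]; simp

lemma strict {m : ℕ} {L : Fin m → M3} (hL : NonUnitalAlgebra.adjoin ℂ (Set.range L) = ⊤)
    {X S : M3} (g : Good X S) (hX : X ≠ 0) (ht : trace X = 0) :
    (trace (S * totalDissipator L X)).re < 0 := by
  by_contra hc
  push Not at hc
  obtain ⟨P, hP⟩ : ∃ P : M3, P = ((1:ℂ)/2) • (1 + S) := ⟨_, rfl⟩
  obtain ⟨Q, hQ⟩ : ∃ Q : M3, Q = ((1:ℂ)/2) • (1 - S) := ⟨_, rfl⟩
  have hPP : P * P = P := by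
    rw [hP]; simp only [smul_mul_smul_comm, Matrix.add_mul, Matrix.mul_add, g.sq, Matrix.one_mul, Matrix.mul_one]
    module
  have hQQ : Q * Q = Q := by
    rw [hQ]; simp only [smul_mul_smul_comm, Matrix.sub_mul, Matrix.mul_sub, g.sq, Matrix.one_mul, Matrix.mul_one]
    module
  have hPQ : P * Q = 0 := by
    rw [hP, hQ]; simp only [smul_mul_smul_comm, Matrix.add_mul, Matrix.mul_sub, g.sq, Matrix.one_mul, Matrix.mul_one]
    module
  have hQP : Q * P = 0 := by
    rw [hP, hQ]; simp only [smul_mul_smul_comm, Matrix.sub_mul, Matrix.mul_add, g.sq, Matrix.one_mul, Matrix.mul_one]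
    module
  have hsum : P + Q = 1 := by rw [hP, hQ]; module
  have hPh : Pᴴ = P := by
    rw [hP, conjTranspose_smul, conjTranspose_add, conjTranspose_one, g.h]; simp
  have hQh : Qᴴ = Q := by
    rw [hQ, conjTranspose_smul, conjTranspose_sub, conjTranspose_one, g.h]; simp
  have hXp : (P * (S * X) * P).PosSemidef := by
    have := g.pos.mul_mul_conjTranspose_same P; rwa [hPh] at this
  have hXm : (Q * (S * X) * Q).PosSemidef := by
    have := g.pos.mul_mul_conjTranspose_same Q; rwa [hQh] at this
  have hXd : X = P * (S * X) * P - Q * (S * X) * Q := by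
    rw [hP, hQ]
    simp only [Matrix.smul_mul, Matrix.mul_smul, smul_smul, Matrix.sub_mul, Matrix.mul_sub,
      Matrix.add_mul, Matrix.mul_add, Matrix.one_mul, Matrix.mul_one, ← Matrix.mul_assoc, g.sq]
    rw [g.comm]
    rw [Matrix.mul_assoc X, g.sq]
    simp only [Matrix.mul_one]
    module
  set Xp := P * (S * X) * P with hXpd
  set Xm := Q * (S * X) * Q with hXmd
  have h1 : ∀ j, 0 ≤ (trace (Q * L j * Xp * (Q * L j)ᴴ)).re := fun j =>
    (Complex.le_def.1 (hXp.mul_mul_conjTranspose_same _).trace_nonneg).1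
  have h2 : ∀ j, 0 ≤ (trace (P * L j * Xm * (P * L j)ᴴ)).re := fun j =>
    (Complex.le_def.1 (hXm.mul_mul_conjTranspose_same _).trace_nonneg).1
  have hd : ∀ j, (trace (S * dissipator (L j) X)).re =
      -2 * ((trace (Q * L j * Xp * (Q * L j)ᴴ)).re + (trace (P * L j * Xm * (P * L j)ᴴ)).re) := by
    intro j
    rw [diss_trace (L j) X S P Q g hP hQ]
    simp [hXpd, hXmd]
  have hz : ∀ j, (trace (S * dissipator (L j) X)).re = 0 := by
    rw [totalDissipator, Finset.mul_sum, trace_sum, Complex.re_sum] at hc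
    have hn : ∀ j ∈ Finset.univ, (trace (S * dissipator (L j) X)).re ≤ 0 := by
      intro j _; rw [hd]; linarith [h1 j, h2 j]
    have := (Finset.sum_eq_zero_iff_of_nonpos hn).1 (le_antisymm (Finset.sum_nonpos hn) hc)
    intro j; exact this j (Finset.mem_univ j)
  have z1 : ∀ j, Q * L j * Xp = 0 := fun j => psd_mul_zero hXp (by linarith [hd j, hz j, h1 j, h2 j])
  have z2 : ∀ j, P * L j * Xm = 0 := fun j => psd_mul_zero hXm (by linarith [hd j, hz j, h1 j, h2 j])
  have htt : trace Xp = trace Xm := by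
    rw [hXd, trace_sub] at ht; exact sub_eq_zero.1 ht
  have n1 : Xp ≠ 0 := by
    intro h0
    have : Xm = 0 := hXm.trace_eq_zero_iff.1 (by rw [← htt, h0, trace_zero])
    apply hX; rw [hXd, h0, this, sub_zero]
  have n2 : Xm ≠ 0 := by
    intro h0
    have : Xp = 0 := hXp.trace_eq_zero_iff.1 (by rw [htt, h0, trace_zero])
    exact n1 this
  have pX : P * Xp = Xp := by rw [hXpd]; simp only [← Matrix.mul_assoc, hPP]
  have qX : Q * Xm = Xm := by rw [hXmd]; simp only [← Matrix.mul_assoc, hQQ]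
  have hPn : P ≠ 0 := by intro h; apply n1; rw [← pX, h, Matrix.zero_mul]
  have hQn : Q ≠ 0 := by intro h; apply n2; rw [← qX, h, Matrix.zero_mul]
  have hr := Matrix.rank_add_rank_le_card_of_mul_eq_zero hPQ
  simp only [Fintype.card_fin] at hr
  rcases (by lia : P.rank ≤ 1 ∨ Q.rank ≤ 1) with h | h
  · have := adjoin_contra hL (P := Q) (Q := P) (by rw [add_comm, hsum])
      (fun j => rank_one_transfer h n1 pX (z1 j)) hQP
    rcases zero_of_forall this with h | h
    exacts [hQn h, hPn h]
  · have := adjoin_contra hL hsum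
      (fun j => rank_one_transfer h n2 qX (z2 j)) hPQ
    rcases zero_of_forall this with h | h
    exacts [hPn h, hQn h]

end Paper

namespace Paper

section Norms
attribute [local instance] Matrix.normedAddCommGroup Matrix.normedSpace

lemma sum_sq_eq (A : M3) : (trace (Aᴴ * A)).re = ∑ i, ∑ j, ‖A j i‖ ^ 2 := by
  simp only [trace, diag_apply, Matrix.mul_apply, conjTranspose_apply, Complex.re_sum]
  refine Finset.sum_congr rfl fun i _ => Finset.sum_congr rfl fun j _ => ?_
  rw [← Complex.normSq_eq_norm_sq, Complex.normSq_apply]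
  simp

lemma sum_sqrt_eig (A : M3) :
    ∑ i, (Matrix.posSemidef_conjTranspose_mul_self A).isHermitian.eigenvalues i
      = ∑ i, ∑ j, ‖A j i‖ ^ 2 := by
  rw [← sum_sq_eq, (Matrix.posSemidef_conjTranspose_mul_self A).isHermitian.trace_eq_sum_eigenvalues]
  simp

lemma norm_le_traceNorm (A : M3) : ‖A‖ ≤ traceNorm A := by
  set e := (Matrix.posSemidef_conjTranspose_mul_self A).isHermitian.eigenvalues with he
  have h0 : ∀ i, 0 ≤ e i := (Matrix.posSemidef_conjTranspose_mul_self A).eigenvalues_nonneg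
  have hT : 0 ≤ traceNorm A := Finset.sum_nonneg fun i _ => Real.sqrt_nonneg _
  rw [Matrix.norm_le_iff hT]
  intro j i
  apply abs_le_of_sq_le_sq' _ hT |>.2
  calc ‖A j i‖ ^ 2 ≤ ∑ j, ‖A j i‖ ^ 2 :=
        Finset.single_le_sum (f := fun j => ‖A j i‖ ^ 2) (fun _ _ => sq_nonneg _) (Finset.mem_univ j)
    _ ≤ ∑ i, ∑ j, ‖A j i‖ ^ 2 :=
        Finset.single_le_sum (f := fun i => ∑ j, ‖A j i‖ ^ 2)
          (fun _ _ => Finset.sum_nonneg fun _ _ => sq_nonneg _) (Finset.mem_univ i)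
    _ = ∑ i, e i := (sum_sqrt_eig A).symm
    _ = ∑ i, Real.sqrt (e i) ^ 2 := Finset.sum_congr rfl fun i _ => (Real.sq_sqrt (h0 i)).symm
    _ ≤ (∑ i, Real.sqrt (e i)) ^ 2 :=
        Finset.sum_sq_le_sq_sum_of_nonneg fun i _ => Real.sqrt_nonneg _

lemma traceNorm_le_norm (A : M3) : traceNorm A ≤ 9 * ‖A‖ := by
  set e := (Matrix.posSemidef_conjTranspose_mul_self A).isHermitian.eigenvalues with he
  have h0 : ∀ i, 0 ≤ e i := (Matrix.posSemidef_conjTranspose_mul_self A).eigenvalues_nonneg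
  have h1 : ∑ i, e i ≤ 9 * ‖A‖ ^ 2 := by
    rw [sum_sqrt_eig A]
    calc _ ≤ ∑ i : Fin 3, ∑ j : Fin 3, ‖A‖ ^ 2 := by
          gcongr; exact Matrix.norm_entry_le_entrywise_sup_norm A
      _ = _ := by simp; ring
  have h2 : ∀ i, Real.sqrt (e i) ≤ 3 * ‖A‖ := by
    intro i
    apply Real.sqrt_le_iff.2 ⟨by positivity, ?_⟩
    calc e i ≤ ∑ i, e i := Finset.single_le_sum (fun i _ => h0 i) (Finset.mem_univ i)
      _ ≤ _ := by rw [mul_pow]; linarith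
  calc traceNorm A = ∑ i, Real.sqrt (e i) := rfl
    _ ≤ ∑ i : Fin 3, 3 * ‖A‖ := Finset.sum_le_sum fun i _ => h2 i
    _ = _ := by simp; ring

lemma norm_sign_le {S : M3} (h : Sᴴ = S) (h2 : S * S = 1) : ‖S‖ ≤ 1 := by
  rw [Matrix.norm_le_iff zero_le_one]
  intro i j
  have h3 : ((Sᴴ * S) j j).re = 1 := by rw [h, h2]; simp
  rw [Matrix.mul_apply, Complex.re_sum] at h3
  have h4 : ∀ k, (Sᴴ j k * S k j).re = ‖S k j‖ ^ 2 := by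
    intro k
    rw [← Complex.normSq_eq_norm_sq, Complex.normSq_apply]
    simp [conjTranspose_apply]
  simp only [h4] at h3
  have := Finset.single_le_sum (f := fun k => ‖S k j‖ ^ 2) (fun _ _ => sq_nonneg _) (Finset.mem_univ i)
  rw [h3] at this
  nlinarith [norm_nonneg (S i j)]

lemma trace_bound {S : M3} (h : Sᴴ = S) (h2 : S * S = 1) (Y : M3) :
    |(trace (S * Y)).re| ≤ 9 * ‖Y‖ := by
  calc |(trace (S * Y)).re| ≤ ‖trace (S * Y)‖ := Complex.abs_re_le_norm _
    _ = ‖∑ i, ∑ j, S i j * Y j i‖ := by simp [trace, Matrix.mul_apply]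
    _ ≤ ∑ i, ∑ j, ‖S i j * Y j i‖ :=
        (norm_sum_le _ _).trans (Finset.sum_le_sum fun i _ => norm_sum_le _ _)
    _ ≤ ∑ i : Fin 3, ∑ j : Fin 3, ‖Y‖ := by
        gcongr with i _ j _
        rw [norm_mul]
        calc _ ≤ 1 * ‖Y‖ := by
              gcongr
              · exact (Matrix.norm_entry_le_entrywise_sup_norm S).trans (norm_sign_le h h2)
              · exact Matrix.norm_entry_le_entrywise_sup_norm Y
          _ = _ := one_mul _
    _ = _ := by simp; ring

lemma dissipator_add (L X Y : M3) : dissipator L (X + Y) = dissipator L X + dissipator L Y := by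
  simp only [dissipator, Matrix.mul_add, Matrix.add_mul]; module

lemma dissipator_smul (L X : M3) (r : ℂ) : dissipator L (r • X) = r • dissipator L X := by
  simp only [dissipator, Matrix.mul_smul, Matrix.smul_mul]; module

/-- the driven Lindbladian as a linear map -/
noncomputable def drivenLin {m : ℕ} (H : ℝ → M3) (L : Fin m → M3) (t : ℝ) : M3 →ₗ[ℂ] M3 where
  toFun := driven H L t
  map_add' X Y := by
    simp only [driven, hamTerm, totalDissipator, dissipator_add, Finset.sum_add_distrib,
      Matrix.mul_add, Matrix.add_mul]
    module
  map_smul' r X := by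
    simp only [driven, hamTerm, totalDissipator, dissipator_smul, ← Finset.smul_sum,
      Matrix.mul_smul, Matrix.smul_mul, RingHom.id_apply]
    module

noncomputable def dissLin {m : ℕ} (L : Fin m → M3) : M3 →ₗ[ℂ] M3 where
  toFun := totalDissipator L
  map_add' X Y := by
    simp only [totalDissipator, dissipator_add, Finset.sum_add_distrib]
  map_smul' r X := by
    simp only [totalDissipator, dissipator_smul, ← Finset.smul_sum, RingHom.id_apply]

lemma isClosed_psd : IsClosed {A : M3 | A.PosSemidef} := by
  have : {A : M3 | A.PosSemidef} = {A : M3 | Aᴴ = A} ∩ ⋂ x : Fin 3 → ℂ, {A : M3 | 0 ≤ star x ⬝ᵥ (A *ᵥ x)} := by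
    ext A
    simp only [Set.mem_ofPred_eq, posSemidef_iff_dotProduct_mulVec, Set.mem_inter_iff, Set.mem_iInter]
    rfl
  rw [this]
  refine IsClosed.inter (isClosed_eq (by fun_prop) (by fun_prop)) (isClosed_iInter fun x => ?_)
  exact isClosed_le (by fun_prop) (by fun_prop)

/-- the compact set of normalized pairs -/
def pairs : Set (M3 × M3) := {p | Good p.1 p.2 ∧ trace p.1 = 0 ∧ ‖p.1‖ = 1}

lemma isCompact_pairs : IsCompact pairs := by
  have hc : IsClosed pairs := by
    have : pairs = ({p : M3 × M3 | p.2ᴴ = p.2} ∩ {p : M3 × M3 | p.2 * p.2 = 1} ∩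
        {p : M3 × M3 | p.2 * p.1 = p.1 * p.2} ∩ (fun p : M3 × M3 => p.2 * p.1) ⁻¹' {A : M3 | A.PosSemidef})
        ∩ ({p : M3 × M3 | trace p.1 = 0} ∩ {p : M3 × M3 | ‖p.1‖ = 1}) := by
      ext p
      constructor
      · rintro ⟨⟨a, b, c, d⟩, e, f⟩
        exact ⟨⟨⟨⟨a, b⟩, c⟩, d⟩, e, f⟩
      · rintro ⟨⟨⟨⟨a, b⟩, c⟩, d⟩, e, f⟩
        exact ⟨⟨a, b, c, d⟩, e, f⟩
    rw [this]
    refine IsClosed.inter (IsClosed.inter (IsClosed.inter (IsClosed.inter ?_ ?_) ?_) ?_)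
      (IsClosed.inter ?_ ?_)
    · exact isClosed_eq (by fun_prop) (by fun_prop)
    · exact isClosed_eq (by fun_prop) (by fun_prop)
    · exact isClosed_eq (by fun_prop) (by fun_prop)
    · exact isClosed_psd.preimage (by fun_prop)
    · exact isClosed_eq (by fun_prop) (by fun_prop)
    · exact isClosed_eq (by fun_prop) (by fun_prop)
  have : ProperSpace M3 := FiniteDimensional.proper ℂ M3
  refine Metric.isCompact_of_isClosed_isBounded hc ?_
  refine (Metric.isBounded_closedBall (x := (0 : M3 × M3)) (r := 1)).subset ?_
  rintro ⟨X, S⟩ ⟨g, _, h⟩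
  simp only [mem_closedBall_zero_iff, Prod.norm_def]
  exact max_le h.le (norm_sign_le g.h g.sq)

lemma good_smul {X S : M3} (g : Good X S) {r : ℝ} (hr : 0 ≤ r) : Good ((r : ℂ) • X) S := by
  refine ⟨g.h, g.sq, ?_, ?_⟩
  · rw [Matrix.mul_smul, Matrix.smul_mul, g.comm]
  · rw [Matrix.mul_smul]
    exact g.pos.smul (by exact_mod_cast hr)

lemma uniform {m : ℕ} {L : Fin m → M3} (hL : NonUnitalAlgebra.adjoin ℂ (Set.range L) = ⊤) :
    ∃ γ c : ℝ, 0 < γ ∧ 0 < c ∧ ∀ X S : M3, Good X S → trace X = 0 →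
      (trace (S * totalDissipator L X)).re ≤ -γ * (trace (S * X)).re ∧
      c * ‖X‖ ≤ (trace (S * X)).re := by
  have hD : Continuous (totalDissipator L) := (dissLin L).continuous_of_finiteDimensional
  have c1 : Continuous fun p : M3 × M3 => (trace (p.2 * p.1)).re :=
    Complex.continuous_re.comp (by fun_prop)
  have c2 : Continuous fun p : M3 × M3 => -(trace (p.2 * totalDissipator L p.1)).re :=
    (Complex.continuous_re.comp (by fun_prop)).neg
  have ne : ∀ p ∈ pairs, p.1 ≠ 0 := by
    rintro p ⟨_, _, h⟩ h0
    rw [h0, norm_zero] at h; exact zero_ne_one h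
  obtain ⟨c, hc, hc'⟩ := isCompact_pairs.exists_forall_le' c1.continuousOn (a := 0)
    (fun p hp => good_pos hp.1 (ne p hp))
  obtain ⟨d, hd, hd'⟩ := isCompact_pairs.exists_forall_le' c2.continuousOn (a := 0)
    (fun p hp => by have := strict hL hp.1 (ne p hp) hp.2.1; linarith)
  refine ⟨d / 9, c, by positivity, hc, ?_⟩
  intro X S g ht
  rcases eq_or_ne X 0 with rfl | hX
  · have : totalDissipator L 0 = 0 := (dissLin L).map_zero
    simp [this]
  have hn : 0 < ‖X‖ := norm_pos_iff.2 hX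
  have hp : ((((‖X‖⁻¹ : ℝ) : ℂ) • X, S) : M3 × M3) ∈ pairs := by
    refine ⟨good_smul g (by positivity), ?_, ?_⟩
    · simp [trace_smul, ht]
    · simp only
      rw [norm_smul]; simp [hn.ne']
  have e1 := hc' _ hp
  have e2 := hd' _ hp
  have hs : totalDissipator L (((‖X‖⁻¹ : ℝ) : ℂ) • X) = ((‖X‖⁻¹ : ℝ) : ℂ) • totalDissipator L X :=
    (dissLin L).map_smul _ _
  simp only [hs, Matrix.mul_smul, trace_smul, smul_eq_mul, Complex.re_ofReal_mul] at e1 e2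
  have e3 := le_of_abs_le (trace_bound g.h g.sq X)
  have i1 : c * ‖X‖ ≤ (trace (S * X)).re := by
    rw [inv_mul_eq_div, le_div_iff₀ hn] at e1; exact e1
  have i2 : d * ‖X‖ ≤ -(trace (S * totalDissipator L X)).re := by
    rw [inv_mul_eq_div, ← neg_div, le_div_iff₀ hn] at e2; exact e2
  refine ⟨?_, i1⟩
  nlinarith

end Norms
end Paper

namespace Paper

section Norms
attribute [local instance] Matrix.normedAddCommGroup Matrix.normedSpace

lemma hasDerivAt_of_entries {X : ℝ → M3} {X' : M3} {t : ℝ}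
    (h : ∀ i j, HasDerivAt (fun u => X u i j) (X' i j) t) : HasDerivAt X X' t := by
  refine hasDerivAt_pi.2 fun i => hasDerivAt_pi.2 fun j => h i j

lemma trace_hamTerm_good {X S : M3} (g : Good X S) (H : M3) : trace (S * hamTerm H X) = 0 := by
  rw [hamTerm, Matrix.mul_smul, trace_smul, Matrix.mul_sub, trace_sub]
  have : trace (S * (H * X)) = trace (S * (X * H)) := by
    rw [trace_mul_comm, Matrix.mul_assoc, ← g.comm, trace_mul_comm, Matrix.mul_assoc]
  rw [this, sub_self, smul_zero]

/-- real part of `tr (S Y)` as a real-linear functional -/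
noncomputable def trFun (S : M3) : M3 →ₗ[ℝ] ℝ where
  toFun Y := (trace (S * Y)).re
  map_add' X Y := by simp [Matrix.mul_add]
  map_smul' r X := by simp

lemma hasDerivAt_trFun (S : M3) {X : ℝ → M3} {X' : M3} {t : ℝ} (h : HasDerivAt X X' t) :
    HasDerivAt (fun u => (trace (S * X u)).re) ((trace (S * X')).re) t :=
  (LinearMap.toContinuousLinearMap (trFun S)).hasFDerivAt.comp_hasDerivAt t h

lemma core {m : ℕ} {L : Fin m → M3} {γ : ℝ}
    (hγ : ∀ X S : M3, Good X S → trace X = 0 →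
      (trace (S * totalDissipator L X)).re ≤ -γ * (trace (S * X)).re)
    (H : ℝ → M3) {s t : ℝ} (hst : s ≤ t) (X : ℝ → M3) (hX : IsSolution (driven H L) s X)
    (Sg : ℝ → M3) (hg : ∀ u, s ≤ u → Good (X u) (Sg u)) (htr : ∀ u, s ≤ u → trace (X u) = 0) :
    (trace (Sg t * X t)).re ≤ Real.exp (-γ * (t - s)) * (trace (Sg s * X s)).re := by
  have hd : ∀ u, s ≤ u → HasDerivAt X (driven H L u (X u)) u := fun u hu =>
    hasDerivAt_of_entries (hX u hu)
  set f : ℝ → ℝ := fun u => (trace (Sg u * X u)).re with hf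
  have hmax : ∀ a b, s ≤ a → s ≤ b → f a - f b ≤ (trace (Sg a * (X a - X b))).re := by
    intro a b ha hb
    have := good_max (hg b hb) (hg a ha).h (hg a ha).sq
    rw [Matrix.mul_sub, trace_sub, Complex.sub_re]
    simp only [hf]; linarith
  have hlip : ∀ a b, s ≤ a → s ≤ b → |f a - f b| ≤ 9 * ‖X a - X b‖ := by
    intro a b ha hb
    rw [abs_le]
    have h1 := le_of_abs_le (trace_bound (hg a ha).h (hg a ha).sq (X a - X b))
    have h2 := le_of_abs_le (trace_bound (hg b hb).h (hg b hb).sq (X b - X a))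
    rw [norm_sub_rev] at h2
    constructor <;> linarith [hmax a b ha hb, hmax b a hb ha]
  have hcont : ContinuousOn (fun u => -f (-u)) (Set.Icc (-t) (-s)) := by
    intro u hu
    have hu' : s ≤ -u := by linarith [hu.2]
    have hXc : Filter.Tendsto (fun v => 9 * ‖X (-v) - X (-u)‖) (nhdsWithin u (Set.Icc (-t) (-s))) (nhds 0) := by
      have h1 : ContinuousAt (fun v => X (-v)) u :=
        ContinuousAt.comp (f := fun v : ℝ => -v) (hd _ hu').continuousAt continuous_neg.continuousAt
      have h2 : ContinuousAt (fun v => 9 * ‖X (-v) - X (-u)‖) u :=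
        continuousAt_const.mul (h1.sub continuousAt_const).norm
      have := h2.tendsto.mono_left (nhdsWithin_le_nhds (s := Set.Icc (-t) (-s)))
      simpa using this
    rw [ContinuousWithinAt, tendsto_iff_norm_sub_tendsto_zero]
    refine squeeze_zero' (Filter.Eventually.of_forall fun _ => norm_nonneg _) ?_ hXc
    filter_upwards [self_mem_nhdsWithin] with v hv
    have := hlip (-v) (-u) (by linarith [hv.2]) hu'
    rw [Real.norm_eq_abs, show -f (-v) - -f (-u) = -(f (-v) - f (-u)) by ring, abs_neg]
    exact this
  have hmain := le_gronwallBound_of_liminf_deriv_right_le (f := fun u => -f (-u))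
    (f' := fun u => (trace (Sg (-u) * driven H L (-u) (X (-u)))).re) (δ := -f t) (K := γ) (ε := 0)
    hcont ?_ (by simp) ?_ (-s) ⟨by linarith, le_refl _⟩
  · rw [gronwallBound_ε0] at hmain
    simp only [neg_neg] at hmain
    have e : Real.exp (-γ * (t - s)) * Real.exp (γ * (-s - -t)) = 1 := by
      rw [← Real.exp_add]; ring_nf; simp
    have := mul_le_mul_of_nonneg_left hmain (Real.exp_pos (-γ * (t - s))).le
    change f t ≤ Real.exp (-γ * (t - s)) * f s
    calc f t = f t * (Real.exp (-γ * (t - s)) * Real.exp (γ * (-s - -t))) := by rw [e, mul_one]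
      _ ≤ _ := by linarith
  · intro u hu r hr
    have hu' : s ≤ -u := by linarith [hu.2]
    apply Filter.Eventually.frequently
    have h1 : HasDerivAt (fun v => -(trace (Sg (-u) * X (-v))).re)
        ((trace (Sg (-u) * driven H L (-u) (X (-u)))).re) u := by
      have h2 := hasDerivAt_trFun (Sg (-u)) (hd _ hu')
      have h3 := (HasDerivAt.scomp u (g₁ := fun v => (trace (Sg (-u) * X v)).re) h2 (hasDerivAt_neg u)).neg
      exact h3.congr_deriv (by simp)
    have h4 := hasDerivAt_iff_tendsto_slope.1 h1
    have h5 := (h4.mono_left (nhdsWithin_mono u (s := Set.Ioi u) (fun x hx => ne_of_gt hx))).eventually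
      (gt_mem_nhds hr)
    filter_upwards [h5, Ioo_mem_nhdsGT hu.2] with z hz hz2
    refine lt_of_le_of_lt ?_ hz
    rw [slope_def_field, div_eq_inv_mul]
    apply mul_le_mul_of_nonneg_left _ (inv_nonneg.2 (by linarith [hz2.1]))
    have := hmax (-u) (-z) hu' (by linarith [hz2.2])
    rw [Matrix.mul_sub, trace_sub, Complex.sub_re] at this
    linarith
  · intro u hu
    have hu' : s ≤ -u := by linarith [hu.2]
    have := hγ _ _ (hg _ hu') (htr _ hu')
    simp only [driven, Matrix.mul_add, trace_add, trace_hamTerm_good (hg _ hu'), zero_add]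
    simp only [hf]; linarith

lemma core' {m : ℕ} {L : Fin m → M3} {γ c : ℝ} (hc : 0 < c)
    (hγ : ∀ X S : M3, Good X S → trace X = 0 →
      (trace (S * totalDissipator L X)).re ≤ -γ * (trace (S * X)).re ∧
      c * ‖X‖ ≤ (trace (S * X)).re)
    (H : ℝ → M3) {s t : ℝ} (hst : s ≤ t) (X : ℝ → M3) (hX : IsSolution (driven H L) s X)
    (hh : ∀ u, (X u).IsHermitian) (htr : ∀ u, s ≤ u → trace (X u) = 0) :
    ‖X t‖ ≤ 9 / c * Real.exp (-γ * (t - s)) * ‖X s‖ := by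
  choose Sg hg using fun u => exists_good (X u) (hh u)
  have h1 := core (fun X S g h => (hγ X S g h).1) H hst X hX Sg (fun u _ => hg u) htr
  have h2 := (hγ _ _ (hg t) (htr t hst)).2
  have h3 := le_of_abs_le (trace_bound (hg s).h (hg s).sq (X s))
  have h4 : c * ‖X t‖ ≤ Real.exp (-γ * (t - s)) * (9 * ‖X s‖) :=
    h2.trans (h1.trans (by gcongr))
  rw [show 9 / c * Real.exp (-γ * (t - s)) * ‖X s‖ = (Real.exp (-γ * (t - s)) * (9 * ‖X s‖)) / c by ring,
    le_div_iff₀ hc]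
  linarith

lemma trace_driven {m : ℕ} (H : ℝ → M3) (L : Fin m → M3) (t : ℝ) (X : M3) :
    trace (driven H L t X) = 0 := by
  have h1 : trace (hamTerm (H t) X) = 0 := by
    rw [hamTerm, trace_smul, trace_sub, trace_mul_comm, sub_self, smul_zero]
  have h2 : ∀ M : M3, trace (dissipator M X) = 0 := by
    intro M
    rw [dissipator, trace_sub, trace_smul, trace_add, trace_mul_comm X, Matrix.mul_assoc M,
      trace_mul_comm M, Matrix.mul_assoc X, trace_mul_comm X]
    simp only [smul_eq_mul]; ring
  rw [driven, trace_add, h1, totalDissipator, trace_sum]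
  simp [h2]

lemma trace_const {m : ℕ} {H : ℝ → M3} {L : Fin m → M3} {s : ℝ} {X : ℝ → M3}
    (hX : IsSolution (driven H L) s X) (h0 : trace (X s) = 0) (t : ℝ) (ht : s ≤ t) :
    trace (X t) = 0 := by
  have hd : ∀ u, s ≤ u → HasDerivAt (fun u => trace (X u)) 0 u := by
    intro u hu
    rw [← trace_driven H L u (X u)]
    simp only [trace, diag_apply]
    exact HasDerivAt.fun_sum fun i _ => hX u hu i i
  have := constant_of_has_deriv_right_zero (f := fun u => trace (X u)) (a := s) (b := t)
    (fun u hu => (hd u hu.1).continuousAt.continuousWithinAt)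
    (fun u hu => (hd u hu.1).hasDerivWithinAt) t ⟨ht, le_refl _⟩
  rw [this, h0]

lemma driven_conjTranspose {m : ℕ} {H : ℝ → M3} (hH : ∀ t, (H t).IsHermitian) (L : Fin m → M3)
    (t : ℝ) (X : M3) : driven H L t Xᴴ = (driven H L t X)ᴴ := by
  have h1 : hamTerm (H t) Xᴴ = (hamTerm (H t) X)ᴴ := by
    rw [hamTerm, hamTerm, conjTranspose_smul, conjTranspose_sub, conjTranspose_mul,
      conjTranspose_mul, (hH t).eq]
    simp only [star_neg, Complex.star_def, Complex.conj_I]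
    module
  have h2 : ∀ M : M3, dissipator M Xᴴ = (dissipator M X)ᴴ := by
    intro M
    simp only [dissipator, conjTranspose_smul, conjTranspose_sub, conjTranspose_mul,
      conjTranspose_add, conjTranspose_conjTranspose]
    simp only [Matrix.mul_assoc, add_comm]
    simp
  rw [driven, driven, conjTranspose_add, h1, totalDissipator, totalDissipator, conjTranspose_sum]
  simp only [h2]

lemma sol_lin {m : ℕ} {H : ℝ → M3} {L : Fin m → M3} {s : ℝ} {X Y : ℝ → M3}
    (hX : IsSolution (driven H L) s X) (hY : IsSolution (driven H L) s Y) (a b : ℂ) :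
    IsSolution (driven H L) s (fun u => a • X u + b • Y u) := by
  intro t ht i j
  have e : driven H L t (a • X t + b • Y t) = a • driven H L t (X t) + b • driven H L t (Y t) := by
    change drivenLin H L t _ = a • drivenLin H L t (X t) + b • drivenLin H L t (Y t)
    rw [map_add, map_smul, map_smul]
  rw [e]
  exact ((hX t ht i j).const_mul a).add ((hY t ht i j).const_mul b)

lemma sol_star {m : ℕ} {H : ℝ → M3} (hH : ∀ t, (H t).IsHermitian) {L : Fin m → M3} {s : ℝ} {X : ℝ → M3}
    (hX : IsSolution (driven H L) s X) :
    IsSolution (driven H L) s (fun u => (X u)ᴴ) := by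
  intro t ht i j
  rw [driven_conjTranspose hH]
  exact (hX t ht j i).star

theorem forward {m : ℕ} (L : Fin m → M3) (hL : NonUnitalAlgebra.adjoin ℂ (Set.range L) = ⊤) :
    HamIndepContractive L := by
  intro H hH
  obtain ⟨γ, c, hγ, hc, hu⟩ := uniform hL
  refine ⟨9 * (9 / c), γ, by positivity, hγ, ?_⟩
  intro s t _ hst ρ σ hρ hσ dρ dσ
  set X : ℝ → M3 := fun u => (1:ℂ) • ρ u + (-1:ℂ) • σ u with hXd
  have hX : IsSolution (driven H L) s X := sol_lin hρ hσ 1 (-1)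
  have hXs := sol_star hH.1 hX
  have eX : ∀ u, X u = ρ u - σ u := fun u => by simp only [hXd]; module
  have h0 : trace (X s) = 0 := by rw [eX, trace_sub, dρ.2, dσ.2, sub_self]
  have hHs : (X s)ᴴ = X s := by
    rw [eX, conjTranspose_sub, dρ.1.isHermitian.eq, dσ.1.isHermitian.eq]
  have hY := sol_lin hX hXs Complex.I (-Complex.I)
  have hZ := sol_lin hX hXs (1/2) (1/2)
  have y := core' hc hu H hst _ hY (fun u => by
    simp only [IsHermitian, conjTranspose_add, conjTranspose_smul, conjTranspose_conjTranspose]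
    simp [add_comm]) (trace_const hY (by simp [h0]))
  have z := core' hc hu H hst _ hZ (fun u => by
    simp only [IsHermitian, conjTranspose_add, conjTranspose_smul, conjTranspose_conjTranspose]
    simp [add_comm]) (trace_const hZ (by simp [h0]))
  have y0 : Complex.I • X t + -Complex.I • (X t)ᴴ = 0 := by
    rw [← norm_le_zero_iff]
    refine y.trans (le_of_eq ?_)
    simp only [hHs]
    simp
  have hHt : (X t)ᴴ = X t := by
    have : Complex.I • (X t - (X t)ᴴ) = 0 := by rw [← y0]; module
    rw [smul_eq_zero, sub_eq_zero] at this
    rcases this with h | h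
    · exact absurd h Complex.I_ne_zero
    · exact h.symm
  have e2 : ∀ A : M3, ((1:ℂ)/2) • A + ((1:ℂ)/2) • A = A := fun A => by module
  simp only [hHs, hHt, e2] at z
  rw [← eX, ← eX]
  calc traceNorm (X t) ≤ 9 * ‖X t‖ := traceNorm_le_norm _
    _ ≤ 9 * (9 / c * Real.exp (-γ * (t - s)) * ‖X s‖) := by gcongr
    _ ≤ 9 * (9 / c * Real.exp (-γ * (t - s)) * traceNorm (X s)) := by
        gcongr; exact norm_le_traceNorm _
    _ = _ := by ring

end Norms
end Paper

namespace Paper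

section Norms
attribute [local instance] Matrix.normedAddCommGroup Matrix.normedSpace

lemma exists_flow {E : Type*} [NormedAddCommGroup E] [NormedSpace ℂ E] [FiniteDimensional ℂ E]
    (Φ : E →ₗ[ℂ] E) (x : E) : ∃ ρ : ℝ → E, ρ 0 = x ∧ ∀ t, HasDerivAt ρ (Φ (ρ t)) t := by
  have : CompleteSpace E := FiniteDimensional.complete ℂ E
  let Λ : E →L[ℂ] E := LinearMap.toContinuousLinearMap Φ
  refine ⟨fun t => (NormedSpace.exp (t • Λ)) x, by simp, ?_⟩
  intro t
  have h1 : HasDerivAt (fun u : ℝ => NormedSpace.exp (u • Λ)) (Λ * NormedSpace.exp (t • Λ)) t :=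
    hasDerivAt_exp_smul_const' Λ t
  exact ((ContinuousLinearMap.apply ℂ E x).restrictScalars ℝ).hasFDerivAt.comp_hasDerivAt t h1

lemma exists_solution {m : ℕ} (L : Fin m → M3) (ρ0 : M3) :
    ∃ ρ : ℝ → M3, ρ 0 = ρ0 ∧ IsSolution (driven (fun _ => 0) L) 0 ρ := by
  obtain ⟨ρ, h0, h⟩ := exists_flow (drivenLin (fun _ => 0) L 0) ρ0
  refine ⟨ρ, h0, ?_⟩
  intro t _ i j
  exact hasDerivAt_pi.1 (hasDerivAt_pi.1 (h t) i) j

lemma trace_diss_comm {Q M : M3} (h1 : Q * M = M * Q) (h2 : Q * Mᴴ = Mᴴ * Q) (X : M3) :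
    trace (Q * dissipator M X) = 0 := by
  rw [dissipator, Matrix.mul_sub, Matrix.mul_smul, Matrix.mul_add, trace_sub, trace_smul, trace_add]
  have e1 : trace (Q * (M * X * Mᴴ)) = trace (Q * (Mᴴ * M * X)) := by
    rw [← Matrix.mul_assoc, trace_mul_comm, ← Matrix.mul_assoc, ← Matrix.mul_assoc, ← h2]
    simp only [Matrix.mul_assoc]
  have e2 : trace (Q * (X * (Mᴴ * M))) = trace (Q * (Mᴴ * M * X)) := by
    rw [← Matrix.mul_assoc, trace_mul_comm, ← Matrix.mul_assoc, ← Matrix.mul_assoc Q,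
      Matrix.mul_assoc _ M Q, ← h1, ← Matrix.mul_assoc, ← h2]
    simp only [Matrix.mul_assoc]
  rw [e1, e2]; simp only [smul_eq_mul]; ring

lemma trace_Q_const {m : ℕ} {L : Fin m → M3} {Q : M3} (h1 : ∀ j, Q * L j = L j * Q)
    (h2 : ∀ j, Q * (L j)ᴴ = (L j)ᴴ * Q) {X : ℝ → M3}
    (hX : IsSolution (driven (fun _ => 0) L) 0 X) (t : ℝ) (ht : 0 ≤ t) :
    trace (Q * X t) = trace (Q * X 0) := by
  have hd : ∀ u, 0 ≤ u → HasDerivAt (fun u => trace (Q * X u)) 0 u := by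
    intro u hu
    have e : trace (Q * driven (fun _ => 0) L u (X u)) = 0 := by
      simp only [driven, hamTerm, totalDissipator, Matrix.mul_add, Finset.mul_sum, trace_add, trace_sum]
      simp [trace_diss_comm (h1 _) (h2 _)]
    rw [← e]
    simp only [trace, diag_apply, Matrix.mul_apply]
    exact HasDerivAt.fun_sum fun i _ => HasDerivAt.fun_sum fun j _ => (hX u hu j i).const_mul _
  exact constant_of_has_deriv_right_zero (f := fun u => trace (Q * X u)) (a := 0) (b := t)
    (fun u hu => (hd u hu.1).continuousAt.continuousWithinAt)
    (fun u hu => (hd u hu.1).hasDerivWithinAt) t ⟨ht, le_refl _⟩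

lemma trace_bound' (S Y : M3) : ‖trace (S * Y)‖ ≤ 9 * ‖S‖ * ‖Y‖ := by
  calc ‖trace (S * Y)‖ = ‖∑ i, ∑ j, S i j * Y j i‖ := by simp [trace, Matrix.mul_apply]
    _ ≤ ∑ i, ∑ j, ‖S i j * Y j i‖ :=
        (norm_sum_le _ _).trans (Finset.sum_le_sum fun i _ => norm_sum_le _ _)
    _ ≤ ∑ i : Fin 3, ∑ j : Fin 3, ‖S‖ * ‖Y‖ := by
        gcongr with i _ j _
        rw [norm_mul]
        gcongr
        · exact Matrix.norm_entry_le_entrywise_sup_norm S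
        · exact Matrix.norm_entry_le_entrywise_sup_norm Y
    _ = _ := by simp; ring

lemma comm_zero {m : ℕ} {L : Fin m → M3} (hL : HamIndepContractive L) {Q : M3} (hQ : Qᴴ = Q)
    (htr : trace Q = 0) (h1 : ∀ j, Q * L j = L j * Q)
    (h2 : ∀ j, Q * (L j)ᴴ = (L j)ᴴ * Q) : Q = 0 := by
  by_contra hne
  obtain ⟨K, γ, hK, hγ, hc⟩ := hL (fun _ => 0) ⟨fun _ => isHermitian_zero, fun i j => continuous_const⟩
  obtain ⟨a, ha⟩ : ∃ a : ℝ, trace (Q * Q) = (a : ℂ) := by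
    refine ⟨(trace (Q * Q)).re, ?_⟩
    have := Complex.le_def.1 (posSemidef_conjTranspose_mul_self Q).trace_nonneg
    rw [hQ] at this
    apply Complex.ext
    · simp
    · simpa using this.2.symm
  have ha0 : 0 ≤ a := by
    have := (posSemidef_conjTranspose_mul_self Q).trace_nonneg
    rw [hQ, ha] at this
    exact_mod_cast this
  have hane : a ≠ 0 := by
    intro h0
    rw [h0] at ha
    apply hne
    rw [← trace_conjTranspose_mul_self_eq_zero_iff, hQ, ha]; simp
  have ha1 : 0 < a := lt_of_le_of_ne ha0 hane.symm
  have dens : ∀ e : ℂ, star e = e → e * e = 1 →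
      IsDensity ((((3 + a)⁻¹ : ℝ) : ℂ) • ((1 + e • Q) * (1 + e • Q))) := by
    intro e he hee
    constructor
    · have : (1 + e • Q)ᴴ = 1 + e • Q := by
        rw [conjTranspose_add, conjTranspose_smul, he, hQ, conjTranspose_one]
      have h3 := posSemidef_conjTranspose_mul_self (1 + e • Q)
      rw [this] at h3
      exact h3.smul (by exact_mod_cast (by positivity : (0:ℝ) ≤ (3 + a)⁻¹))
    · have h4 : (1 + e • Q) * (1 + e • Q) = 1 + (2 * e) • Q + (e * e) • (Q * Q) := by
        simp only [Matrix.add_mul, Matrix.mul_add, Matrix.one_mul, Matrix.mul_one, smul_mul_smul_comm]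
        module
      have h5 : (3 + (a:ℂ)) ≠ 0 := by exact_mod_cast (by positivity : (3 + a) ≠ 0)
      rw [h4, hee, trace_smul, trace_add, trace_add, trace_smul, trace_smul, htr, ha]
      simp
      field_simp
  obtain ⟨ρ, hρ0, hρ⟩ := exists_solution L ((((3 + a)⁻¹ : ℝ) : ℂ) • ((1 + (1:ℂ) • Q) * (1 + (1:ℂ) • Q)))
  obtain ⟨σ, hσ0, hσ⟩ := exists_solution L ((((3 + a)⁻¹ : ℝ) : ℂ) • ((1 + (-1:ℂ) • Q) * (1 + (-1:ℂ) • Q)))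
  have hdiff : trace (Q * (ρ 0 - σ 0)) = (((3 + a)⁻¹ * (4 * a) : ℝ) : ℂ) := by
    have : ρ 0 - σ 0 = (((3 + a)⁻¹ : ℝ) : ℂ) • ((4:ℂ) • Q) := by
      rw [hρ0, hσ0]
      simp only [Matrix.add_mul, Matrix.mul_add, Matrix.one_mul, Matrix.mul_one, smul_mul_smul_comm]
      module
    rw [this]
    simp only [Matrix.mul_smul, trace_smul, ha]
    push_cast
    simp
  have hbd : ∀ t : ℝ, 0 ≤ t → (3 + a)⁻¹ * (4 * a) ≤
      9 * ‖Q‖ * (K * Real.exp (-γ * (t - 0)) * traceNorm (ρ 0 - σ 0)) := by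
    intro t ht
    have e : trace (Q * (ρ t - σ t)) = trace (Q * (ρ 0 - σ 0)) := by
      rw [Matrix.mul_sub, Matrix.mul_sub, trace_sub, trace_sub, trace_Q_const h1 h2 hρ t ht,
        trace_Q_const h1 h2 hσ t ht]
    have b := trace_bound' Q (ρ t - σ t)
    rw [e, hdiff, Complex.norm_real] at b
    have hcc := hc 0 t le_rfl ht ρ σ hρ hσ (by rw [hρ0]; exact dens 1 (by simp) (by simp))
      (by rw [hσ0]; exact dens (-1) (by simp) (by simp))
    calc _ ≤ _ := le_trans (le_abs_self _) b
      _ ≤ _ := by gcongr; exact (norm_le_traceNorm _).trans hcc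
  have hlim : Filter.Tendsto (fun t : ℝ => 9 * ‖Q‖ * (K * Real.exp (-γ * (t - 0)) * traceNorm (ρ 0 - σ 0)))
      Filter.atTop (nhds 0) := by
    have h3 : Filter.Tendsto (fun t : ℝ => Real.exp (-γ * (t - 0))) Filter.atTop (nhds 0) := by
      apply Real.tendsto_exp_atBot.comp
      simp only [sub_zero]
      exact Filter.tendsto_id.const_mul_atTop_of_neg (by linarith)
    have := ((h3.const_mul K).mul_const (traceNorm (ρ 0 - σ 0))).const_mul (9 * ‖Q‖)
    simpa using this
  have := ge_of_tendsto hlim (Filter.eventually_atTop.2 ⟨0, hbd⟩)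
  have : 0 < (3 + a)⁻¹ * (4 * a) := by positivity
  linarith

lemma comm_scalar {m : ℕ} {L : Fin m → M3} (hL : HamIndepContractive L) {C : M3}
    (h1 : ∀ j, C * L j = L j * C) (h2 : ∀ j, C * (L j)ᴴ = (L j)ᴴ * C) :
    C = (trace C / 3) • (1 : M3) := by
  have h3 : ∀ j, Cᴴ * L j = L j * Cᴴ := fun j => by
    have := congrArg conjTranspose (h2 j)
    simpa [conjTranspose_mul] using this.symm
  have h4 : ∀ j, Cᴴ * (L j)ᴴ = (L j)ᴴ * Cᴴ := fun j => by
    have := congrArg conjTranspose (h1 j)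
    simpa [conjTranspose_mul] using this.symm
  obtain ⟨B, hB⟩ : ∃ B : M3, B = C - (trace C / 3) • (1 : M3) := ⟨_, rfl⟩
  have hBt : trace B = 0 := by
    rw [hB, trace_sub, trace_smul, trace_one]; simp
  have hB' : Bᴴ = Cᴴ - star (trace C / 3) • (1 : M3) := by
    rw [hB, conjTranspose_sub, conjTranspose_smul, conjTranspose_one]
  have b1 : ∀ j, B * L j = L j * B := fun j => by
    rw [hB, Matrix.sub_mul, Matrix.mul_sub, h1]; simp
  have b2 : ∀ j, B * (L j)ᴴ = (L j)ᴴ * B := fun j => by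
    rw [hB, Matrix.sub_mul, Matrix.mul_sub, h2]; simp
  have b3 : ∀ j, Bᴴ * L j = L j * Bᴴ := fun j => by
    rw [hB', Matrix.sub_mul, Matrix.mul_sub, h3]; simp
  have b4 : ∀ j, Bᴴ * (L j)ᴴ = (L j)ᴴ * Bᴴ := fun j => by
    rw [hB', Matrix.sub_mul, Matrix.mul_sub, h4]; simp
  have r1 : B + Bᴴ = 0 := by
    apply comm_zero hL
    · simp [add_comm]
    · rw [trace_add, trace_conjTranspose, hBt]; simp
    · intro j; rw [Matrix.add_mul, Matrix.mul_add, b1, b3]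
    · intro j; rw [Matrix.add_mul, Matrix.mul_add, b2, b4]
  have r2 : Complex.I • (B - Bᴴ) = 0 := by
    apply comm_zero hL
    · rw [conjTranspose_smul, conjTranspose_sub, conjTranspose_conjTranspose]
      simp only [Complex.star_def, Complex.conj_I]; module
    · rw [trace_smul, trace_sub, trace_conjTranspose, hBt]; simp
    · intro j; rw [Matrix.smul_mul, Matrix.mul_smul, Matrix.sub_mul, Matrix.mul_sub, b1, b3]
    · intro j; rw [Matrix.smul_mul, Matrix.mul_smul, Matrix.sub_mul, Matrix.mul_sub, b2, b4]
  have r3 : B - Bᴴ = 0 := by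
    rcases smul_eq_zero.1 r2 with h | h
    · exact absurd h Complex.I_ne_zero
    · exact h
  have : B = 0 := by
    have : B = ((1:ℂ)/2) • ((B + Bᴴ) + (B - Bᴴ)) := by module
    rw [this, r1, r3]; simp
  rw [hB] at this
  exact sub_eq_zero.1 this

/-- the trace form -/
noncomputable def trForm : LinearMap.BilinForm ℂ M3 :=
  LinearMap.mk₂ ℂ (fun x y => trace (x * y)) (by intros; simp [Matrix.add_mul])
    (by intros; simp) (by intros; simp [Matrix.mul_add]) (by intros; simp)

theorem backward {m : ℕ} (L : Fin m → M3) (hL : HamIndepContractive L) :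
    NonUnitalAlgebra.adjoin ℂ (Set.range L ∪ Set.range fun j => (L j)ᴴ) = ⊤ := by
  set A := NonUnitalAlgebra.adjoin ℂ (Set.range L ∪ Set.range fun j => (L j)ᴴ) with hA
  have hLA : ∀ j, L j ∈ A := fun j => NonUnitalAlgebra.subset_adjoin ℂ (Or.inl ⟨j, rfl⟩)
  have hLA' : ∀ j, (L j)ᴴ ∈ A := fun j => NonUnitalAlgebra.subset_adjoin ℂ (Or.inr ⟨j, rfl⟩)
  have hstar : ∀ x ∈ A, xᴴ ∈ A := by
    intro x hx
    induction hx using NonUnitalAlgebra.adjoin_induction with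
    | mem x hx =>
      rcases hx with ⟨j, rfl⟩ | ⟨j, rfl⟩
      · exact hLA' j
      · simpa using hLA j
    | add x y _ _ hx hy => rw [conjTranspose_add]; exact add_mem hx hy
    | zero => rw [conjTranspose_zero]; exact zero_mem A
    | mul x y _ _ hx hy => rw [conjTranspose_mul]; exact mul_mem hy hx
    | smul r x _ hx => rw [conjTranspose_smul]; exact SMulMemClass.smul_mem _ hx
  let W : Submodule ℂ M3 := A.toSubmodule
  have hW : ∀ x, x ∈ W ↔ x ∈ A := fun x => Iff.rfl
  have hrefl : trForm.IsRefl := by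
    intro x y h
    change trace (y * x) = 0
    rw [trace_mul_comm]; exact h
  have horth : ∀ x, x ∈ trForm.orthogonal W ↔ ∀ a ∈ A, trace (a * x) = 0 := by
    intro x; rfl
  have hcompl : IsCompl W (trForm.orthogonal W) := by
    rw [LinearMap.BilinForm.isCompl_orthogonal_iff_disjoint hrefl, Submodule.disjoint_def]
    intro x hx hx'
    have := (horth x).1 hx' _ (hstar x hx)
    exact trace_conjTranspose_mul_self_eq_zero_iff.1 this
  let T := W.projection _ hcompl
  have hTm : ∀ x, T x ∈ A := fun x => Submodule.projection_apply_mem hcompl x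
  have hTa : ∀ x ∈ A, T x = x := fun x hx => Submodule.projection_apply_of_mem_left hcompl hx
  have hTmul : ∀ a ∈ A, ∀ x, T (a * x) = a * T x := by
    intro a ha x
    have h1 : x - T x ∈ trForm.orthogonal W := by
      rw [← Submodule.projection_apply_eq_zero_iff hcompl]
      change T (x - T x) = 0
      rw [map_sub, hTa _ (hTm x), sub_self]
    have h2 : a * (x - T x) ∈ trForm.orthogonal W := by
      rw [horth] at h1 ⊢
      intro b hb
      rw [← Matrix.mul_assoc]
      exact h1 _ (mul_mem hb ha)
    have h3 : T (a * (x - T x)) = 0 := (Submodule.projection_apply_eq_zero_iff hcompl).2 h2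
    rw [Matrix.mul_sub, map_sub, hTa _ (mul_mem ha (hTm x)), sub_eq_zero] at h3
    exact h3
  -- coefficients
  let C : Fin 3 → Fin 3 → M3 := fun k l => Matrix.of fun i j => T (Matrix.single j k 1) i l
  have hC : ∀ k l, ∀ a ∈ A, C k l * a = a * C k l := by
    intro k l a ha
    ext i j
    have h1 : a * Matrix.single j k (1:ℂ) = ∑ p, a p j • Matrix.single p k (1:ℂ) := by
      ext x y
      rw [Matrix.sum_apply]
      simp only [Matrix.smul_apply, Matrix.mul_apply, Matrix.single_apply, smul_eq_mul]
      by_cases hy : k = y <;> simp [hy]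
    have h2 := hTmul a ha (Matrix.single j k 1)
    rw [h1, map_sum] at h2
    have h3 := congrFun (congrFun h2 i) l
    rw [Matrix.sum_apply] at h3
    simp only [map_smul, Matrix.smul_apply, smul_eq_mul, Matrix.mul_apply] at h3
    simp only [Matrix.mul_apply, C, Matrix.of_apply]
    rw [← h3]
    exact Finset.sum_congr rfl fun p _ => mul_comm _ _
  have hCs : ∀ k l, C k l = (trace (C k l) / 3) • (1 : M3) := fun k l =>
    comm_scalar hL (fun j => hC k l _ (hLA j)) (fun j => hC k l _ (hLA' j))
  let e : M3 := Matrix.of fun k l => trace (C k l) / 3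
  have hTe : ∀ x, T x = x * e := by
    intro x
    conv_lhs => rw [Matrix.matrix_eq_sum_single x]
    ext i l
    rw [map_sum, Matrix.sum_apply]
    have h1 : ∀ j k, T (Matrix.single j k (x j k)) i l = x j k * (e k l * (1 : M3) i j) := by
      intro j k
      have h2 : Matrix.single j k (x j k) = x j k • Matrix.single j k (1:ℂ) := by simp
      rw [h2, map_smul, Matrix.smul_apply, smul_eq_mul]
      congr 1
      have := congrFun (congrFun (hCs k l) i) j
      simpa [C, e] using this
    simp only [map_sum, Matrix.sum_apply, h1]
    rw [Matrix.mul_apply, Finset.sum_eq_single i]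
    · simp
    · intro b _ hb; simp [Matrix.one_apply_ne hb.symm]
    · simp
  have heA : e ∈ A := by
    have := hTm 1
    rwa [hTe, Matrix.one_mul] at this
  have hae : ∀ a ∈ A, a * e = a := fun a ha => by rw [← hTe, hTa a ha]
  have heh : eᴴ = e := by
    have h1 := hae _ (hstar e heA)
    have h2 := congrArg conjTranspose h1
    rw [conjTranspose_mul, conjTranspose_conjTranspose, h1] at h2
    exact h2
  have hea : ∀ a ∈ A, e * a = a := fun a ha => by
    have := congrArg conjTranspose (hae _ (hstar a ha))
    simpa [conjTranspose_mul, heh] using this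
  have hes := comm_scalar hL (C := e) (fun j => by rw [hae _ (hLA j), hea _ (hLA j)])
    (fun j => by rw [hae _ (hLA' j), hea _ (hLA' j)])
  have hz : trace e / 3 ≠ 0 := by
    intro h0
    rw [h0, zero_smul] at hes
    have hL0 : ∀ j, L j = 0 := fun j => by rw [← hae _ (hLA j), hes, Matrix.mul_zero]
    have := comm_scalar hL (C := Matrix.single 0 1 1) (fun j => by simp [hL0]) (fun j => by simp [hL0])
    have := congrFun (congrFun this 0) 1
    simp at this
  rw [eq_top_iff]
  intro x _
  generalize trace e / 3 = q at hes hz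
  have : x = T (q⁻¹ • x) := by
    rw [hTe]
    conv_rhs => rw [hes]
    rw [smul_mul_smul_comm, Matrix.mul_one, inv_mul_cancel₀ hz, one_smul]
  rw [this]
  exact hTm _

end Norms

/-- on `M₃(ℂ)`, if `{L_j}` alone generates the full matrix algebra, the
dissipator is Hamiltonian-independently contractive; conversely, Hamiltonian-independent
contractivity implies that `{L_j, L_j†}` generates the full matrix algebra. -/
theorem qutrit_dissipator_conditions {m : ℕ} (L : Fin m → Matrix (Fin 3) (Fin 3) ℂ) :
    ((NonUnitalAlgebra.adjoin ℂ (Set.range L) = ⊤) → HamIndepContractive L) ∧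
    (HamIndepContractive L →
      NonUnitalAlgebra.adjoin ℂ
        (Set.range L ∪ Set.range fun j => (L j)ᴴ) = ⊤) :=
  ⟨forward L, backward L⟩

end Paper
end
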